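/- arXiv:1603.07294 — 8 statements merged into one kernel-verified Lean document; each statement's English description precedes it below -/
import Mathlib

section
/- Suppose the log-likelihood satisfies sup_{x,x' ∈ 𝒳, θ ∈ Θ} |log f(x',θ) − log f(x,θ)| ≤ C for a finite constant C. Then releasing one sample from the posterior distribution is 2C-differentially private: for any two datasets X, X' of the same length N that differ in exactly one entry, and any measurable set S ⊆ Θ, μ_X(S) ≤ exp(2C) · μ_{X'}(S). -/
open MeasureTheory ENNReal

/-- Positive reals whose logarithms differ by at most `C` have ratio at most `exp C`. -/
theorem le_exp_mul_of_abs_log_sub_log_le {a b C : ℝ} (ha : 0 < a) (hb : 0 < b)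
    (h : |Real.log a - Real.log b| ≤ C) : a ≤ Real.exp C * b := by
  rw [← Real.log_le_log_iff ha (by positivity), Real.log_mul (Real.exp_ne_zero C) hb.ne',
    Real.log_exp]
  linarith [le_of_abs_le h]

/-- Changing one observation changes the unnormalized posterior mass of any set by a factor of
at most `exp C`. -/
theorem setLIntegral_likelihood_le {𝒳 Θ ι : Type*} [Fintype ι] [MeasurableSpace Θ]
    (π : Measure Θ) {f : 𝒳 → Θ → ℝ} (hf_pos : ∀ x θ, 0 < f x θ) {C : ℝ}
    (hC : ∀ x x' θ, |Real.log (f x' θ) - Real.log (f x θ)| ≤ C)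
    {X X' : ι → 𝒳} {j : ι} (hj : ∀ i, i ≠ j → X i = X' i) (S : Set Θ) :
    (∫⁻ θ in S, ENNReal.ofReal (∏ i, f (X i) θ) ∂π) ≤
      ENNReal.ofReal (Real.exp C) * ∫⁻ θ in S, ENNReal.ofReal (∏ i, f (X' i) θ) ∂π := by
  classical
  rw [← lintegral_const_mul' _ _ ENNReal.ofReal_ne_top]
  refine lintegral_mono fun θ => ?_
  rw [← ENNReal.ofReal_mul (Real.exp_pos C).le]
  refine ENNReal.ofReal_le_ofReal ?_
  rw [← Finset.mul_prod_erase _ _ (Finset.mem_univ j),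
    ← Finset.mul_prod_erase _ (fun i => f (X' i) θ) (Finset.mem_univ j), ← mul_assoc,
    Finset.prod_congr rfl fun i hi => by rw [hj i (Finset.ne_of_mem_erase hi)]]
  exact mul_le_mul_of_nonneg_right
    (le_exp_mul_of_abs_log_sub_log_le (hf_pos _ _) (hf_pos _ _) (hC _ _ _))
    (Finset.prod_nonneg fun i _ => (hf_pos _ _).le)

/-- If numerators and denominators are comparable up to a factor `c`, the quotients are
comparable up to `c * c`. -/
theorem ENNReal.div_le_mul_self_mul_div {a a' z z' c : ℝ≥0∞} (hc₀ : c ≠ 0) (hc : c ≠ ∞)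
    (ha : a ≤ c * a') (hz : z' ≤ c * z) : a / z ≤ c * c * (a' / z') := by
  have hinv : z⁻¹ ≤ c * z'⁻¹ := calc
    z⁻¹ = c * (c * z)⁻¹ := by
      rw [ENNReal.mul_inv (Or.inl hc₀) (Or.inl hc), ← mul_assoc,
        ENNReal.mul_inv_cancel hc₀ hc, one_mul]
    _ ≤ c * z'⁻¹ := by gcongr
  calc a / z = a * z⁻¹ := div_eq_mul_inv _ _
    _ ≤ c * a' * (c * z'⁻¹) := mul_le_mul' ha hinv
    _ = c * c * (a' / z') := by rw [div_eq_mul_inv]; ring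

/-- One posterior sample is `2C`-differentially private when the log-likelihood has
bounded differences: `sup_{x,x',θ} |log f(x',θ) − log f(x,θ)| ≤ C`. -/
theorem one_posterior_sample_dp
    {𝒳 Θ : Type*} [MeasurableSpace 𝒳] [MeasurableSpace Θ]
    (π : Measure Θ) [IsProbabilityMeasure π]
    (f : 𝒳 → Θ → ℝ)
    (hf_pos : ∀ x θ, 0 < f x θ)
    (hf_meas : ∀ x, Measurable (f x))
    (C : ℝ)
    (hC : ∀ x x' θ, |Real.log (f x' θ) - Real.log (f x θ)| ≤ C)
    (N : ℕ)
    (hZ : ∀ Y : Fin N → 𝒳,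
      0 < (∫⁻ θ, ENNReal.ofReal (∏ i, f (Y i) θ) ∂π) ∧
      (∫⁻ θ, ENNReal.ofReal (∏ i, f (Y i) θ) ∂π) < ⊤)
    (X X' : Fin N → 𝒳)
    (hneighbor : ∃ j, X j ≠ X' j ∧ ∀ i, i ≠ j → X i = X' i)
    (S : Set Θ) (hS : MeasurableSet S) :
    (∫⁻ θ in S, ENNReal.ofReal (∏ i, f (X i) θ) ∂π) /
        (∫⁻ θ, ENNReal.ofReal (∏ i, f (X i) θ) ∂π) ≤
      ENNReal.ofReal (Real.exp (2 * C)) *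
        ((∫⁻ θ in S, ENNReal.ofReal (∏ i, f (X' i) θ) ∂π) /
          (∫⁻ θ, ENNReal.ofReal (∏ i, f (X' i) θ) ∂π)) := by
  obtain ⟨j, -, hj⟩ := hneighbor
  have hZX := setLIntegral_likelihood_le π hf_pos hC (fun i hi => (hj i hi).symm) Set.univ
  rw [Measure.restrict_univ] at hZX
  rw [two_mul, Real.exp_add, ENNReal.ofReal_mul (Real.exp_pos C).le]
  exact ENNReal.div_le_mul_self_mul_div (by simp [Real.exp_pos]) ENNReal.ofReal_ne_top
    (setLIntegral_likelihood_le π hf_pos hC hj S) hZX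
end

section
/- Suppose the log-likelihood satisfies sup_{x ∈ 𝒳, θ ∈ Θ} |log f(x,θ)| ≤ B for a finite constant B. Then releasing one sample from the posterior distribution is 4B-differentially private: for any two datasets X, X' of the same length N that differ in exactly one entry, and any measurable set S ⊆ Θ, μ_X(S) ≤ exp(4B) · μ_{X'}(S). -/
open MeasureTheory ENNReal

theorem le_exp_two_mul_mul_of_abs_log_le {a b B : ℝ} (ha : 0 < a) (hb : 0 < b)
    (hla : |Real.log a| ≤ B) (hlb : |Real.log b| ≤ B) : a ≤ Real.exp (2 * B) * b := by
  rw [← Real.log_le_log_iff ha (by positivity), Real.log_mul (Real.exp_ne_zero _) hb.ne',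
    Real.log_exp]
  linarith [(abs_le.mp hla).2, (abs_le.mp hlb).1]

/-- Replacing one observation changes the likelihood by a factor of at most `exp (2 * B)`. -/
theorem prod_likelihood_le_exp_two_mul_mul {𝒳 Θ ι : Type*} [Fintype ι] {f : 𝒳 → Θ → ℝ} {B : ℝ}
    (hf_pos : ∀ x θ, 0 < f x θ) (hB : ∀ x θ, |Real.log (f x θ)| ≤ B) {X X' : ι → 𝒳} {j : ι}
    (h : ∀ i, i ≠ j → X i = X' i) (θ : Θ) :
    ∏ i, f (X i) θ ≤ Real.exp (2 * B) * ∏ i, f (X' i) θ := by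
  classical
  rw [← Finset.mul_prod_erase Finset.univ (fun i => f (X i) θ) (Finset.mem_univ j),
    ← Finset.mul_prod_erase Finset.univ (fun i => f (X' i) θ) (Finset.mem_univ j),
    Finset.prod_congr rfl fun i hi => by rw [h i (Finset.ne_of_mem_erase hi)], ← mul_assoc]
  exact mul_le_mul_of_nonneg_right
    (le_exp_two_mul_mul_of_abs_log_le (hf_pos _ _) (hf_pos _ _) (hB _ _) (hB _ _))
    (Finset.prod_nonneg fun i _ => (hf_pos _ _).le)

theorem lintegral_ofReal_le_ofReal_mul_lintegral {Θ : Type*} [MeasurableSpace Θ] (μ : Measure Θ)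
    {g g' : Θ → ℝ} {c : ℝ} (hc : 0 ≤ c) (h : ∀ θ, g θ ≤ c * g' θ) :
    ∫⁻ θ, ENNReal.ofReal (g θ) ∂μ ≤ ENNReal.ofReal c * ∫⁻ θ, ENNReal.ofReal (g' θ) ∂μ := by
  rw [← lintegral_const_mul' _ _ ENNReal.ofReal_ne_top]
  refine lintegral_mono fun θ => ?_
  rw [← ENNReal.ofReal_mul hc]
  exact ENNReal.ofReal_le_ofReal (h θ)

theorem ENNReal.div_le_mul_mul_div {a a' z z' c : ℝ≥0∞} (hc : c ≠ 0) (hc' : c ≠ ∞)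
    (ha : a ≤ c * a') (hz : z' ≤ c * z) : a / z ≤ c * c * (a' / z') := by
  have hinv : z⁻¹ ≤ c * z'⁻¹ := by
    calc z⁻¹ = c * (c * z)⁻¹ := by
          rw [ENNReal.mul_inv (.inl hc) (.inl hc'), ← mul_assoc, ENNReal.mul_inv_cancel hc hc',
            one_mul]
      _ ≤ c * z'⁻¹ := by gcongr
  calc a / z = a * z⁻¹ := div_eq_mul_inv _ _
    _ ≤ (c * a') * (c * z'⁻¹) := by gcongr
    _ = c * c * (a' / z') := by rw [div_eq_mul_inv]; ring

/-- One posterior sample is `4B`-differentially private when the log-likelihood has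
bounded magnitude: `sup_{x,θ} |log f(x,θ)| ≤ B`; the privacy cost is `4B`. -/
theorem one_posterior_sample_dp_bounded_loglik
    {𝒳 Θ : Type*} [MeasurableSpace 𝒳] [MeasurableSpace Θ]
    (π : Measure Θ) [IsProbabilityMeasure π]
    (f : 𝒳 → Θ → ℝ)
    (hf_pos : ∀ x θ, 0 < f x θ)
    (hf_meas : ∀ x, Measurable (f x))
    (B : ℝ)
    (hB : ∀ x θ, |Real.log (f x θ)| ≤ B)
    (N : ℕ)
    (hZ : ∀ Y : Fin N → 𝒳,
      0 < (∫⁻ θ, ENNReal.ofReal (∏ i, f (Y i) θ) ∂π) ∧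
      (∫⁻ θ, ENNReal.ofReal (∏ i, f (Y i) θ) ∂π) < ⊤)
    (X X' : Fin N → 𝒳)
    (hneighbor : ∃ j, X j ≠ X' j ∧ ∀ i, i ≠ j → X i = X' i)
    (S : Set Θ) (hS : MeasurableSet S) :
    (∫⁻ θ in S, ENNReal.ofReal (∏ i, f (X i) θ) ∂π) /
        (∫⁻ θ, ENNReal.ofReal (∏ i, f (X i) θ) ∂π) ≤
      ENNReal.ofReal (Real.exp (4 * B)) *
        ((∫⁻ θ in S, ENNReal.ofReal (∏ i, f (X' i) θ) ∂π) /
          (∫⁻ θ, ENNReal.ofReal (∏ i, f (X' i) θ) ∂π)) := by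
  obtain ⟨j, -, hj⟩ := hneighbor
  have hc : ENNReal.ofReal (Real.exp (4 * B)) =
      ENNReal.ofReal (Real.exp (2 * B)) * ENNReal.ofReal (Real.exp (2 * B)) := by
    rw [← ENNReal.ofReal_mul (Real.exp_pos _).le, ← Real.exp_add]
    ring_nf
  rw [hc]
  exact ENNReal.div_le_mul_mul_div (ENNReal.ofReal_pos.mpr (Real.exp_pos _)).ne'
    ENNReal.ofReal_ne_top
    (lintegral_ofReal_le_ofReal_mul_lintegral _ (Real.exp_pos _).le
      (prod_likelihood_le_exp_two_mul_mul hf_pos hB hj))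
    (lintegral_ofReal_le_ofReal_mul_lintegral _ (Real.exp_pos _).le
      (prod_likelihood_le_exp_two_mul_mul hf_pos hB fun i hi => (hj i hi).symm))
end

section
/- Fix a current state θ ∈ ℝ^d, a symmetric measurable proposal density q(θ,θ') on ℝ^d, ε > 0, and set T = 2Δ/ε. Consider the Metropolis update mechanism whose output, for dataset X, lies in ℝ^d ⊎ {reject}: on the accept branch the output has density θ' ↦ q(θ,θ')·α_X(θ,θ') with respect to Lebesgue measure, where α_X(θ,θ') = min(1, (p_X(θ')/p_X(θ))^{1/T}), and the remaining mass r_X = ∫ q(θ,θ')(1 − α_X(θ,θ')) dθ' is placed on the atom 'reject'. If r_X ≤ δ for every dataset X, then the mechanism is (ε,δ)-differentially private: for any neighboring datasets X, X' and any measurable set S of outcomes, P_X(S) ≤ exp(ε)·P_{X'}(S) + δ. -/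
open scoped Classical

open MeasureTheory

/-- The tempered Metropolis acceptance probability of a normalized density is determined by the
difference of log joint probabilities. -/
theorem min_one_div_rpow_eq_min_one_exp {a b Z : ℝ} (hZ : Z ≠ 0) (s : ℝ) :
    min 1 ((Real.exp a / Z / (Real.exp b / Z)) ^ s) = min 1 (Real.exp ((a - b) * s)) := by
  rw [div_div_div_cancel_right₀ hZ, ← Real.exp_sub, ← Real.exp_mul]

theorem min_one_exp_le_exp_mul_min_one_exp {a b ε : ℝ} (hε : 0 ≤ ε) (h : a ≤ ε + b) :
    min 1 (Real.exp a) ≤ Real.exp ε * min 1 (Real.exp b) := by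
  rw [mul_min_of_nonneg _ _ (Real.exp_pos ε).le, mul_one, ← Real.exp_add]
  exact min_le_min (Real.one_le_exp hε) (Real.exp_le_exp.mpr h)

/-- The Metropolis update mechanism (accept branch with density `q·α` on `ℝ^d`, remaining
mass on the `reject` atom) at temperature `T = 2Δ/ε` is `(ε,δ)`-differentially private
whenever the rejection probability is at most `δ` for every dataset. -/
theorem metropolis_update_dp
    {𝒳 : Type*} [MeasurableSpace 𝒳] {d : ℕ}
    (π : EuclideanSpace ℝ (Fin d) → ℝ) (hπ_pos : ∀ θ, 0 < π θ)
    (hπ_meas : Measurable π)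
    (f : 𝒳 → EuclideanSpace ℝ (Fin d) → ℝ)
    (hf_pos : ∀ x θ, 0 < f x θ)
    (hf_meas : ∀ x, Measurable (f x))
    (N : ℕ)
    (L : EuclideanSpace ℝ (Fin d) → (Fin N → 𝒳) → ℝ)
    (hL : ∀ θ Xs, L θ Xs = Real.log (π θ) + ∑ i, Real.log (f (Xs i) θ))
    (hnorm : ∀ Xs : Fin N → 𝒳, Integrable (fun θ => Real.exp (L θ Xs)))
    (p : (Fin N → 𝒳) → EuclideanSpace ℝ (Fin d) → ℝ)
    (hp : ∀ Xs θ, p Xs θ = Real.exp (L θ Xs) / ∫ θ', Real.exp (L θ' Xs))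
    (Δ ε δ : ℝ) (hΔ_pos : 0 < Δ) (hε : 0 < ε)
    (hΔ : ∀ (θ : EuclideanSpace ℝ (Fin d)) (Xs Xs' : Fin N → 𝒳),
      (∃ j, Xs j ≠ Xs' j ∧ ∀ i, i ≠ j → Xs i = Xs' i) →
      |L θ Xs - L θ Xs'| ≤ Δ)
    (T : ℝ) (hT : T = 2 * Δ / ε)
    -- symmetric measurable proposal density
    (q : EuclideanSpace ℝ (Fin d) → EuclideanSpace ℝ (Fin d) → ℝ)
    (hq_symm : ∀ a b, q a b = q b a)
    (hq_nonneg : ∀ a b, 0 ≤ q a b)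
    (hq_meas : Measurable (Function.uncurry q))
    (hq_int : ∀ a, ∫ b, q a b = 1)
    -- current state
    (θ : EuclideanSpace ℝ (Fin d))
    -- acceptance probability
    (accept : (Fin N → 𝒳) → EuclideanSpace ℝ (Fin d) → EuclideanSpace ℝ (Fin d) → ℝ)
    (haccept : ∀ Xs θ₀ θ',
      accept Xs θ₀ θ' = min 1 ((p Xs θ' / p Xs θ₀) ^ (1 / T)))
    -- rejection probability
    (r : (Fin N → 𝒳) → ℝ)
    (hr : ∀ Xs, r Xs = ∫ θ', q θ θ' * (1 - accept Xs θ θ'))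
    (hrδ : ∀ Xs : Fin N → 𝒳, r Xs ≤ δ)
    -- the output measure on ℝ^d ⊎ {reject}
    (P : (Fin N → 𝒳) → Set (EuclideanSpace ℝ (Fin d) ⊕ Unit) → ℝ)
    (hP : ∀ Xs S, P Xs S =
      (∫ θ' in {t | Sum.inl t ∈ S}, q θ θ' * accept Xs θ θ') +
        (if Sum.inr () ∈ S then r Xs else 0)) :
    ∀ X₁ X₂ : Fin N → 𝒳,
      (∃ j, X₁ j ≠ X₂ j ∧ ∀ i, i ≠ j → X₁ i = X₂ i) →
      ∀ S : Set (EuclideanSpace ℝ (Fin d) ⊕ Unit), MeasurableSet S →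
        P X₁ S ≤ Real.exp ε * P X₂ S + δ := by
  intro X₁ X₂ hX S _
  have hT_pos : 0 < T := by rw [hT]; positivity
  have haccept_exp (Xs θ') :
      accept Xs θ θ' = min 1 (Real.exp ((L θ' Xs - L θ Xs) * (1 / T))) := by
    rw [haccept, hp, hp, min_one_div_rpow_eq_min_one_exp (integral_exp_pos (hnorm Xs)).ne']
  have hL_meas (Xs) : Measurable fun θ' => L θ' Xs := by
    simp only [hL]
    exact hπ_meas.log.add (Finset.measurable_sum _ fun i _ => (hf_meas (Xs i)).log)
  have haccept_nonneg (Xs θ') : 0 ≤ accept Xs θ θ' := by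
    rw [haccept_exp]; positivity
  have haccept_le_one (Xs θ') : accept Xs θ θ' ≤ 1 := by
    rw [haccept_exp]; exact min_le_left _ _
  have haccept_meas (Xs) : Measurable (accept Xs θ) := by
    have h : accept Xs θ = fun θ' => min 1 (Real.exp ((L θ' Xs - L θ Xs) * (1 / T))) :=
      funext (haccept_exp Xs)
    rw [h]
    exact measurable_const.min (((hL_meas Xs).sub_const _).mul_const _).exp
  have hq_integrable : Integrable (q θ) := by
    by_contra h
    simpa [integral_undef h] using hq_int θ
  have hint (Xs) : Integrable fun θ' => q θ θ' * accept Xs θ θ' := by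
    refine hq_integrable.mono
      (hq_integrable.aestronglyMeasurable.mul (haccept_meas Xs).aestronglyMeasurable)
      (Filter.Eventually.of_forall fun θ' => ?_)
    rw [norm_mul, Real.norm_of_nonneg (haccept_nonneg Xs θ')]
    exact mul_le_of_le_one_right (norm_nonneg _) (haccept_le_one Xs θ')
  have hr_nonneg (Xs) : 0 ≤ r Xs := by
    rw [hr]
    exact integral_nonneg fun θ' =>
      mul_nonneg (hq_nonneg _ _) (sub_nonneg.mpr (haccept_le_one Xs θ'))
  have hratio (θ') : accept X₁ θ θ' ≤ Real.exp ε * accept X₂ θ θ' := by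
    rw [haccept_exp, haccept_exp]
    refine min_one_exp_le_exp_mul_min_one_exp hε.le ?_
    have h₁ := abs_le.mp (hΔ θ' X₁ X₂ hX)
    have h₂ := abs_le.mp (hΔ θ X₁ X₂ hX)
    have hεT : ε * T = 2 * Δ := by rw [hT]; field_simp
    rw [mul_one_div, mul_one_div, ← sub_le_iff_le_add, ← sub_div, div_le_iff₀ hT_pos, hεT]
    linarith [h₁.2, h₂.1]
  have haccepted : ∫ θ' in {t | Sum.inl t ∈ S}, q θ θ' * accept X₁ θ θ' ≤
      Real.exp ε * ∫ θ' in {t | Sum.inl t ∈ S}, q θ θ' * accept X₂ θ θ' := by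
    rw [← integral_const_mul]
    refine integral_mono (hint X₁).integrableOn ((hint X₂).const_mul _).integrableOn fun θ' => ?_
    calc q θ θ' * accept X₁ θ θ' ≤ q θ θ' * (Real.exp ε * accept X₂ θ θ') :=
          mul_le_mul_of_nonneg_left (hratio θ') (hq_nonneg _ _)
      _ = Real.exp ε * (q θ θ' * accept X₂ θ θ') := by ring
  have hreject : (if Sum.inr () ∈ S then r X₁ else 0) ≤
      Real.exp ε * (if Sum.inr () ∈ S then r X₂ else 0) + δ := by
    split_ifs
    · linarith [hrδ X₁, mul_nonneg (Real.exp_pos ε).le (hr_nonneg X₂)]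
    · linarith [hrδ X₁, hr_nonneg X₁]
  rw [hP, hP]
  linarith
end

section
/- Fix ε > 0 and set T = 2Δ/ε, and for a dataset X define the Metropolis acceptance probability α_X(θ,θ') = min(1, (p_X(θ')/p_X(θ))^{1/T}). Then for any two neighboring datasets X₁, X₂ and any θ, θ' ∈ ℝ^d, the acceptance probabilities satisfy α_{X₁}(θ,θ') ≤ exp(ε)·α_{X₂}(θ,θ'). -/
open MeasureTheory

/-- For the Metropolis acceptance probability at temperature `T = 2Δ/ε` targeting the
posterior, neighboring datasets give acceptance probabilities within a factor `exp ε`. -/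
theorem metropolis_accept_ratio_dp
    {𝒳 : Type*} [MeasurableSpace 𝒳] {d : ℕ}
    (π : EuclideanSpace ℝ (Fin d) → ℝ) (hπ_pos : ∀ θ, 0 < π θ)
    (hπ_meas : Measurable π)
    (f : 𝒳 → EuclideanSpace ℝ (Fin d) → ℝ)
    (hf_pos : ∀ x θ, 0 < f x θ)
    (hf_meas : ∀ x, Measurable (f x))
    (N : ℕ)
    (L : EuclideanSpace ℝ (Fin d) → (Fin N → 𝒳) → ℝ)
    (hL : ∀ θ Xs, L θ Xs = Real.log (π θ) + ∑ i, Real.log (f (Xs i) θ))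
    (hnorm : ∀ Xs : Fin N → 𝒳, Integrable (fun θ => Real.exp (L θ Xs)))
    (p : (Fin N → 𝒳) → EuclideanSpace ℝ (Fin d) → ℝ)
    (hp : ∀ Xs θ, p Xs θ = Real.exp (L θ Xs) / ∫ θ', Real.exp (L θ' Xs))
    (Δ ε : ℝ) (hΔ_pos : 0 < Δ) (hε : 0 < ε)
    (hΔ : ∀ (θ : EuclideanSpace ℝ (Fin d)) (Xs Xs' : Fin N → 𝒳),
      (∃ j, Xs j ≠ Xs' j ∧ ∀ i, i ≠ j → Xs i = Xs' i) →
      |L θ Xs - L θ Xs'| ≤ Δ)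
    (T : ℝ) (hT : T = 2 * Δ / ε)
    (accept : (Fin N → 𝒳) → EuclideanSpace ℝ (Fin d) → EuclideanSpace ℝ (Fin d) → ℝ)
    (haccept : ∀ Xs θ θ',
      accept Xs θ θ' = min 1 ((p Xs θ' / p Xs θ) ^ (1 / T)))
    (X₁ X₂ : Fin N → 𝒳)
    (hneighbor : ∃ j, X₁ j ≠ X₂ j ∧ ∀ i, i ≠ j → X₁ i = X₂ i)
    (θ θ' : EuclideanSpace ℝ (Fin d)) :
    accept X₁ θ θ' ≤ Real.exp ε * accept X₂ θ θ' := by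
  have accept_eq (Xs : Fin N → 𝒳) :
      accept Xs θ θ' = min 1 (Real.exp ((L θ' Xs - L θ Xs) * (1 / T))) := by
    have hZ : (∫ η, Real.exp (L η Xs)) ≠ 0 := (integral_exp_pos (hnorm Xs)).ne'
    rw [haccept, hp, hp, div_div_div_cancel_right₀ hZ, ← Real.exp_sub, ← Real.exp_mul]
  rw [accept_eq, accept_eq, mul_min_of_nonneg _ _ (Real.exp_pos ε).le, mul_one, ← Real.exp_add]
  refine min_le_min (Real.one_le_exp hε.le) (Real.exp_le_exp.mpr ?_)
  have hT_pos : 0 < T := by rw [hT]; positivity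
  have hεT : ε * T = 2 * Δ := by rw [hT]; field_simp
  have h := abs_le.mp (hΔ θ X₁ X₂ hneighbor)
  have h' := abs_le.mp (hΔ θ' X₁ X₂ hneighbor)
  rw [mul_one_div, mul_one_div, div_le_iff₀ hT_pos, add_mul, div_mul_cancel₀ _ hT_pos.ne', hεT]
  linarith [h.1, h'.2]
end

section
/- Let Θ = Θ_1 × ⋯ × Θ_D be a product of measurable spaces and fix an index l and fixed values θ_{¬l} of all coordinates other than l. Suppose C_l = sup_{x,x' ∈ 𝒳, θ_l ∈ Θ_l} |log f(x', (θ_l, θ_{¬l})) − log f(x, (θ_l, θ_{¬l}))| is finite. Then the Gibbs update that samples the coordinate θ_l from its conditional posterior given θ_{¬l} and the data is 2C_l-differentially private: for any neighboring datasets X, X' and any measurable set S ⊆ Θ_l, μ_{X,l}(S) ≤ exp(2C_l) · μ_{X',l}(S), where μ_{X,l} is the probability measure on Θ_l with density θ_l ↦ ∏_{i=1}^N f(x_i,(θ_l,θ_{¬l})) (normalized) with respect to the conditional prior π_l(·|θ_{¬l}), assuming the normalizer is positive and finite. -/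
open MeasureTheory ENNReal

/-- Two densities within a constant factor `c` of each other have normalizations within `c ^ 2`. -/
theorem setLIntegral_div_lintegral_le {α : Type*} [MeasurableSpace α] {μ : Measure α}
    {g h : α → ℝ≥0∞} {c : ℝ≥0∞} (hc₀ : c ≠ 0) (hc : c ≠ ⊤)
    (hgh : ∀ t, g t ≤ c * h t) (hhg : ∀ t, h t ≤ c * g t) (S : Set α) :
    (∫⁻ t in S, g t ∂μ) / (∫⁻ t, g t ∂μ) ≤
      c ^ 2 * ((∫⁻ t in S, h t ∂μ) / (∫⁻ t, h t ∂μ)) := by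
  have hS : ∫⁻ t in S, g t ∂μ ≤ c * ∫⁻ t in S, h t ∂μ :=
    (lintegral_mono hgh).trans_eq (lintegral_const_mul' _ _ hc)
  have hZ : ∫⁻ t, h t ∂μ ≤ c * ∫⁻ t, g t ∂μ :=
    (lintegral_mono hhg).trans_eq (lintegral_const_mul' _ _ hc)
  have hinv : (∫⁻ t, g t ∂μ)⁻¹ ≤ c * (∫⁻ t, h t ∂μ)⁻¹ :=
    calc (∫⁻ t, g t ∂μ)⁻¹ = c * (c * ∫⁻ t, g t ∂μ)⁻¹ := by
          rw [ENNReal.mul_inv (Or.inl hc₀) (Or.inl hc), ← mul_assoc,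
            ENNReal.mul_inv_cancel hc₀ hc, one_mul]
      _ ≤ c * (∫⁻ t, h t ∂μ)⁻¹ := by gcongr
  calc (∫⁻ t in S, g t ∂μ) / (∫⁻ t, g t ∂μ)
      ≤ (c * ∫⁻ t in S, h t ∂μ) * (c * (∫⁻ t, h t ∂μ)⁻¹) := by
        rw [div_eq_mul_inv]
        exact mul_le_mul' hS hinv
    _ = c ^ 2 * ((∫⁻ t in S, h t ∂μ) / (∫⁻ t, h t ∂μ)) := by
        rw [div_eq_mul_inv]
        ring

/-- Changing one factor of a positive product by at most `C` on the log scale changes the product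
by a factor of at most `exp C`. -/
theorem prod_le_exp_mul_prod_of_eq_off {ι : Type*} [Fintype ι] {a b : ι → ℝ} {C : ℝ} {j : ι}
    (ha : ∀ i, 0 < a i) (hb : ∀ i, 0 < b i) (hne : ∀ i, i ≠ j → a i = b i)
    (hj : |Real.log (a j) - Real.log (b j)| ≤ C) :
    ∏ i, a i ≤ Real.exp C * ∏ i, b i := by
  classical
  have hab : a j ≤ Real.exp C * b j := by
    rw [← Real.log_le_log_iff (ha j) (mul_pos (Real.exp_pos C) (hb j)),
      Real.log_mul (Real.exp_pos C).ne' (hb j).ne', Real.log_exp]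
    linarith [le_abs_self (Real.log (a j) - Real.log (b j))]
  rw [← Finset.mul_prod_erase _ a (Finset.mem_univ j),
    ← Finset.mul_prod_erase _ b (Finset.mem_univ j), ← mul_assoc,
    Finset.prod_congr rfl fun i hi => hne i (Finset.ne_of_mem_erase hi)]
  exact mul_le_mul_of_nonneg_right hab (Finset.prod_nonneg fun i _ => (hb i).le)

/-- A Gibbs update of coordinate `l`, holding the other coordinates fixed, is
`2C_l`-differentially private when the log-likelihood differences along coordinate `l`
are bounded by `C_l`. -/
theorem gibbs_update_dp
    {𝒳 : Type*} [MeasurableSpace 𝒳] {D : ℕ}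
    (Θ : Fin D → Type*) [∀ i, MeasurableSpace (Θ i)]
    (l : Fin D) (θfix : ∀ i, Θ i)
    -- conditional prior on coordinate l given the fixed remaining coordinates
    (πl : Measure (Θ l)) [IsProbabilityMeasure πl]
    (f : 𝒳 → (∀ i, Θ i) → ℝ)
    (hf_pos : ∀ x θ, 0 < f x θ)
    (hf_meas : ∀ x, Measurable fun t : Θ l => f x (Function.update θfix l t))
    (C : ℝ)
    (hC : ∀ x x' (t : Θ l),
      |Real.log (f x' (Function.update θfix l t)) -
        Real.log (f x (Function.update θfix l t))| ≤ C)
    (N : ℕ)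
    (hZ : ∀ Y : Fin N → 𝒳,
      0 < (∫⁻ t, ENNReal.ofReal (∏ i, f (Y i) (Function.update θfix l t)) ∂πl) ∧
      (∫⁻ t, ENNReal.ofReal (∏ i, f (Y i) (Function.update θfix l t)) ∂πl) < ⊤)
    (X X' : Fin N → 𝒳)
    (hneighbor : ∃ j, X j ≠ X' j ∧ ∀ i, i ≠ j → X i = X' i)
    (S : Set (Θ l)) (hS : MeasurableSet S) :
    (∫⁻ t in S, ENNReal.ofReal (∏ i, f (X i) (Function.update θfix l t)) ∂πl) /
        (∫⁻ t, ENNReal.ofReal (∏ i, f (X i) (Function.update θfix l t)) ∂πl) ≤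
      ENNReal.ofReal (Real.exp (2 * C)) *
        ((∫⁻ t in S, ENNReal.ofReal (∏ i, f (X' i) (Function.update θfix l t)) ∂πl) /
          (∫⁻ t, ENNReal.ofReal (∏ i, f (X' i) (Function.update θfix l t)) ∂πl)) := by
  obtain ⟨j, -, hne⟩ := hneighbor
  have key : ∀ Y Y' : Fin N → 𝒳, (∀ i, i ≠ j → Y i = Y' i) → ∀ t : Θ l,
      ENNReal.ofReal (∏ i, f (Y i) (Function.update θfix l t)) ≤
        ENNReal.ofReal (Real.exp C) *
          ENNReal.ofReal (∏ i, f (Y' i) (Function.update θfix l t)) := by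
    intro Y Y' hY t
    rw [← ENNReal.ofReal_mul (Real.exp_pos C).le]
    exact ENNReal.ofReal_le_ofReal <| prod_le_exp_mul_prod_of_eq_off
      (fun i => hf_pos (Y i) _) (fun i => hf_pos (Y' i) _)
      (fun i hi => by rw [hY i hi]) (hC (Y' j) (Y j) t)
  have hexp : ENNReal.ofReal (Real.exp (2 * C)) = ENNReal.ofReal (Real.exp C) ^ 2 := by
    rw [← ENNReal.ofReal_pow (Real.exp_pos C).le, ← Real.exp_nat_mul, Nat.cast_ofNat]
  rw [hexp]
  exact setLIntegral_div_lintegral_le (ENNReal.ofReal_pos.2 (Real.exp_pos C)).ne'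
    ENNReal.ofReal_ne_top (key X X' hne) (key X' X fun i hi => (hne i hi).symm) S
end

section
/- For any 0 < a₀ < 1/2, the exponential-mechanism sensitivity of the truncated beta-Bernoulli model equals log(1−a₀) − log a₀; that is, sup over x, x' ∈ {0,1} and p ∈ [a₀, 1−a₀] of |x·log p + (1−x)·log(1−p) − (x'·log p + (1−x')·log(1−p))| = log(1−a₀) − log(a₀). -/
/-- The exponential-mechanism sensitivity of the truncated beta-Bernoulli model:
the supremum over `x, x' ∈ {0,1}` and `p ∈ [a₀, 1−a₀]` of the absolute difference of
Bernoulli log-likelihoods equals `log(1−a₀) − log a₀`. -/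
theorem truncated_beta_bernoulli_sensitivity
    (a₀ : ℝ) (h₀ : 0 < a₀) (h₁ : a₀ < 1 / 2) :
    sSup {v : ℝ | ∃ x x' p : ℝ, (x = 0 ∨ x = 1) ∧ (x' = 0 ∨ x' = 1) ∧
        p ∈ Set.Icc a₀ (1 - a₀) ∧
        v = |x * Real.log p + (1 - x) * Real.log (1 - p) -
              (x' * Real.log p + (1 - x') * Real.log (1 - p))|} =
      Real.log (1 - a₀) - Real.log a₀ := by
  refine IsGreatest.csSup_eq ⟨?_, ?_⟩
  · refine ⟨1, 0, 1 - a₀, Or.inr rfl, Or.inl rfl, ⟨by linarith, le_rfl⟩, ?_⟩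
    have h : Real.log a₀ ≤ Real.log (1 - a₀) := Real.log_le_log h₀ (by linarith)
    rw [sub_sub_cancel, abs_of_nonneg] <;> linarith
  · rintro v ⟨x, x', p, hx, hx', ⟨hp₀, hp₁⟩, rfl⟩
    have log_ge : Real.log a₀ ≤ Real.log p := Real.log_le_log h₀ hp₀
    have log_le : Real.log p ≤ Real.log (1 - a₀) := Real.log_le_log (by linarith) hp₁
    have log_compl_ge : Real.log a₀ ≤ Real.log (1 - p) := Real.log_le_log h₀ (by linarith)
    have log_compl_le : Real.log (1 - p) ≤ Real.log (1 - a₀) :=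
      Real.log_le_log (by linarith) (by linarith)
    rcases hx with rfl | rfl <;> rcases hx' with rfl | rfl <;>
      exact abs_le.mpr ⟨by linarith, by linarith⟩
end

section
/- If the exponential family is minimal, then the log-normalizer A is strictly convex on Θ (which is a convex set), and consequently the mean map θ ↦ E_{p_θ}[S(x)] is injective on the interior of Θ, giving a bijection between natural parameters and mean parameters. -/
open MeasureTheory
open scoped RealInnerProductSpace

section ExpFamily

variable {𝒳 E : Type*} [MeasurableSpace 𝒳] [NormedAddCommGroup E] [InnerProductSpace ℝ E]
  {ν : Measure 𝒳} {S : 𝒳 → E}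

/-- Densities of an exponential family integrate to one. -/
lemma integral_exp_inner_sub_log [NeZero ν] {θ : E}
    (hθ : Integrable (fun x => Real.exp ⟪θ, S x⟫) ν) :
    ∫ x, Real.exp (⟪θ, S x⟫ - Real.log (∫ y, Real.exp ⟪θ, S y⟫ ∂ν)) ∂ν = 1 := by
  have hpos : 0 < ∫ y, Real.exp ⟪θ, S y⟫ ∂ν := integral_exp_pos hθ
  simp_rw [Real.exp_sub, Real.exp_log hpos, integral_div]
  exact div_self hpos.ne'

/-- Two members of an exponential family with the same mean have natural parameters whose
difference is almost everywhere constant on the statistic. -/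
lemma ae_inner_eq_of_integral_smul_eq [CompleteSpace E] {θ η : E} {s t : ℝ}
    (hθ : Integrable (fun x => Real.exp (⟪θ, S x⟫ - s)) ν)
    (hη : Integrable (fun x => Real.exp (⟪η, S x⟫ - t)) ν)
    (hθS : Integrable (fun x => Real.exp (⟪θ, S x⟫ - s) • S x) ν)
    (hηS : Integrable (fun x => Real.exp (⟪η, S x⟫ - t) • S x) ν)
    (hmass : ∫ x, Real.exp (⟪θ, S x⟫ - s) ∂ν = ∫ x, Real.exp (⟪η, S x⟫ - t) ∂ν)
    (hmean : ∫ x, Real.exp (⟪θ, S x⟫ - s) • S x ∂ν = ∫ x, Real.exp (⟪η, S x⟫ - t) • S x ∂ν) :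
    ∀ᵐ x ∂ν, ⟪θ - η, S x⟫ = s - t := by
  set f := fun x => Real.exp (⟪θ, S x⟫ - s)
  set g := fun x => Real.exp (⟪η, S x⟫ - t)
  have hS : Integrable (fun x => ⟪θ - η, f x • S x - g x • S x⟫) ν :=
    (hθS.sub hηS).const_inner _
  have hc : Integrable (fun x => (s - t) * (f x - g x)) ν := (hθ.sub hη).const_mul _
  have heq : ∀ x, ((⟪θ, S x⟫ - s) - (⟪η, S x⟫ - t)) * (f x - g x) =
      ⟪θ - η, f x • S x - g x • S x⟫ - (s - t) * (f x - g x) := by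
    intro x
    rw [← sub_smul, real_inner_smul_right, inner_sub_left]
    ring
  have hnonneg : 0 ≤ fun x => ((⟪θ, S x⟫ - s) - (⟪η, S x⟫ - t)) * (f x - g x) := by
    intro x
    rcases le_total (⟪θ, S x⟫ - s) (⟪η, S x⟫ - t) with h | h
    · exact mul_nonneg_of_nonpos_of_nonpos (sub_nonpos.2 h) (sub_nonpos.2 (Real.exp_le_exp.2 h))
    · exact mul_nonneg (sub_nonneg.2 h) (sub_nonneg.2 (Real.exp_le_exp.2 h))
  have hzero : ∫ x, ((⟪θ, S x⟫ - s) - (⟪η, S x⟫ - t)) * (f x - g x) ∂ν = 0 := by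
    simp_rw [heq]
    rw [integral_sub hS hc, integral_inner (f := fun x => f x • S x - g x • S x) (hθS.sub hηS),
      integral_sub hθS hηS, integral_const_mul, integral_sub hθ hη, hmass, hmean]
    simp
  have hint : Integrable (fun x => ((⟪θ, S x⟫ - s) - (⟪η, S x⟫ - t)) * (f x - g x)) ν := by
    simp_rw [heq]
    exact hS.sub hc
  filter_upwards [(integral_eq_zero_iff_of_nonneg hnonneg hint).1 hzero] with x hx
  rw [inner_sub_left]
  rcases mul_eq_zero.1 hx with h | h
  · linarith
  · have := Real.exp_injective (sub_eq_zero.1 h)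
    linarith

variable [MeasurableSpace E] [BorelSpace E] [FiniteDimensional ℝ E]

lemma measurable_exp_inner (hS : Measurable S) (θ : E) :
    Measurable fun x => Real.exp ⟪θ, S x⟫ :=
  Real.measurable_exp.comp (Measurable.inner measurable_const hS)

lemma lintegral_exp_inner_lt_top_iff (hS : Measurable S) (θ : E) :
    (∫⁻ x, ENNReal.ofReal (Real.exp ⟪θ, S x⟫) ∂ν) < ⊤ ↔
      Integrable (fun x => Real.exp ⟪θ, S x⟫) ν := by
  rw [Integrable, hasFiniteIntegral_iff_ofReal (ae_of_all _ fun _ => (Real.exp_pos _).le)]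
  exact ⟨fun h => ⟨(measurable_exp_inner hS θ).aestronglyMeasurable, h⟩, fun h => h.2⟩

lemma toReal_lintegral_exp_inner (hS : Measurable S) (θ : E) :
    (∫⁻ x, ENNReal.ofReal (Real.exp ⟪θ, S x⟫) ∂ν).toReal = ∫ x, Real.exp ⟪θ, S x⟫ ∂ν :=
  (integral_eq_lintegral_of_nonneg_ae (ae_of_all _ fun _ => (Real.exp_pos _).le)
    (measurable_exp_inner hS θ).aestronglyMeasurable).symm

/-- The set of natural parameters of an exponential family is convex. -/
lemma convex_setOf_integrable_exp_inner (hS : Measurable S) :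
    Convex ℝ {θ : E | Integrable (fun x => Real.exp ⟪θ, S x⟫) ν} := by
  intro θ hθ η hη a b ha hb hab
  refine ((hθ.const_mul a).add (hη.const_mul b)).mono'
    (measurable_exp_inner hS _).aestronglyMeasurable (ae_of_all _ fun x => ?_)
  rw [Real.norm_of_nonneg (Real.exp_pos _).le, inner_add_left, real_inner_smul_left,
    real_inner_smul_left]
  exact convexOn_exp.2 (Set.mem_univ _) (Set.mem_univ _) ha hb hab

/-- The log-normalizer satisfies the strict convexity inequality between two natural parameters
whose difference is not almost everywhere constant on the statistic. -/
lemma log_integral_exp_inner_lt [NeZero ν] (hS : Measurable S) {θ η : E}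
    (hθ : Integrable (fun x => Real.exp ⟪θ, S x⟫) ν)
    (hη : Integrable (fun x => Real.exp ⟪η, S x⟫) ν)
    (hne : ¬ ∃ c : ℝ, ∀ᵐ x ∂ν, ⟪θ - η, S x⟫ = c)
    {a b : ℝ} (ha : 0 < a) (hb : 0 < b) (hab : a + b = 1) :
    Real.log (∫ x, Real.exp ⟪a • θ + b • η, S x⟫ ∂ν) <
      a * Real.log (∫ x, Real.exp ⟪θ, S x⟫ ∂ν) + b * Real.log (∫ x, Real.exp ⟪η, S x⟫ ∂ν) := by
  have hζ : Integrable (fun x => Real.exp ⟪a • θ + b • η, S x⟫) ν :=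
    convex_setOf_integrable_exp_inner hS hθ hη ha.le hb.le hab
  have hθ1 := integral_exp_inner_sub_log hθ
  have hη1 := integral_exp_inner_sub_log hη
  set s := Real.log (∫ x, Real.exp ⟪θ, S x⟫ ∂ν)
  set t := Real.log (∫ x, Real.exp ⟪η, S x⟫ ∂ν)
  have hi : ∀ {ξ : E} (r : ℝ), Integrable (fun x => Real.exp ⟪ξ, S x⟫) ν →
      Integrable (fun x => Real.exp (⟪ξ, S x⟫ - r)) ν := by
    intro ξ r h
    simp_rw [Real.exp_sub]
    exact h.div_const _
  have hcomb : ∀ x, ⟪a • θ + b • η, S x⟫ - (a * s + b * t) =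
      a • (⟪θ, S x⟫ - s) + b • (⟪η, S x⟫ - t) := by
    intro x
    rw [inner_add_left, real_inner_smul_left, real_inner_smul_left, smul_eq_mul, smul_eq_mul]
    ring
  have hsum : Integrable (fun x => a * Real.exp (⟪θ, S x⟫ - s) + b * Real.exp (⟪η, S x⟫ - t)) ν :=
    ((hi s hθ).const_mul a).add ((hi t hη).const_mul b)
  have hgap : 0 ≤ fun x => a * Real.exp (⟪θ, S x⟫ - s) + b * Real.exp (⟪η, S x⟫ - t) -
      Real.exp (⟪a • θ + b • η, S x⟫ - (a * s + b * t)) := by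
    intro x
    simp only [Pi.zero_apply]
    rw [hcomb]
    exact sub_nonneg.2 (convexOn_exp.2 (Set.mem_univ _) (Set.mem_univ _) ha.le hb.le hab)
  have hlt : ∫ x, Real.exp (⟪a • θ + b • η, S x⟫ - (a * s + b * t)) ∂ν < 1 := by
    have hint : ∫ x, (a * Real.exp (⟪θ, S x⟫ - s) + b * Real.exp (⟪η, S x⟫ - t) -
        Real.exp (⟪a • θ + b • η, S x⟫ - (a * s + b * t))) ∂ν =
        1 - ∫ x, Real.exp (⟪a • θ + b • η, S x⟫ - (a * s + b * t)) ∂ν := by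
      rw [integral_sub hsum (hi _ hζ),
        integral_add ((hi s hθ).const_mul a) ((hi t hη).const_mul b),
        integral_const_mul, integral_const_mul, hθ1, hη1, mul_one, mul_one, hab]
    rw [← sub_pos, ← hint]
    refine (integral_nonneg hgap).lt_of_ne' fun h0 => hne ⟨s - t, ?_⟩
    filter_upwards [(integral_eq_zero_iff_of_nonneg hgap (hsum.sub (hi _ hζ))).1 h0] with x hx
    by_contra hx'
    have huv : ⟪θ, S x⟫ - s ≠ ⟪η, S x⟫ - t := by
      rw [inner_sub_left] at hx'
      exact fun h => hx' (by linarith)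
    have hs := strictConvexOn_exp.2 (Set.mem_univ _) (Set.mem_univ _) huv ha hb hab
    rw [← hcomb] at hs
    simp only [Pi.zero_apply, smul_eq_mul] at hx hs
    linarith
  simp_rw [Real.exp_sub, integral_div] at hlt
  rw [div_lt_one (Real.exp_pos _)] at hlt
  exact (Real.log_lt_iff_lt_exp (integral_exp_pos hζ)).2 hlt

/-- The statistic is integrable against the density at interior natural parameters. -/
lemma integrable_exp_inner_smul_of_mem_interior (hS : Measurable S) {θ : E}
    (hθ : θ ∈ interior {θ : E | Integrable (fun x => Real.exp ⟪θ, S x⟫) ν}) :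
    Integrable (fun x => Real.exp ⟪θ, S x⟫ • S x) ν := by
  have hdir : ∀ v : E, Integrable (fun x => Real.exp ⟪θ, S x⟫ * ⟪v, S x⟫) ν := by
    intro v
    have hmem := mem_interior_iff_mem_nhds.1 hθ
    have hlim : ∀ w : E, Filter.Tendsto (fun ε : ℝ => θ + ε • w) (nhdsWithin 0 (Set.Ioi 0))
        (nhds θ) := by
      intro w
      have hc : Continuous fun ε : ℝ => θ + ε • w := by fun_prop
      simpa using (hc.tendsto 0).mono_left nhdsWithin_le_nhds
    obtain ⟨ε, ⟨hp, hm⟩, hε⟩ := (((hlim v).eventually hmem).and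
      ((hlim (-v)).eventually hmem) |>.and self_mem_nhdsWithin).exists
    replace hε : 0 < ε := hε
    refine ((Integrable.add hp hm).div_const ε).mono'
      ((measurable_exp_inner hS θ).mul (Measurable.inner measurable_const hS)).aestronglyMeasurable
      (ae_of_all _ fun x => ?_)
    rw [norm_mul, Real.norm_of_nonneg (Real.exp_pos _).le, Real.norm_eq_abs, le_div_iff₀ hε]
    simp only [Pi.add_apply, inner_add_left, real_inner_smul_left, inner_neg_left, Real.exp_add,
      ← mul_add]
    rw [mul_assoc]
    refine mul_le_mul_of_nonneg_left ?_ (Real.exp_pos _).le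
    have h1 := Real.add_one_le_exp (ε * ⟪v, S x⟫)
    have h2 := Real.add_one_le_exp (ε * -⟪v, S x⟫)
    have h3 := Real.exp_pos (ε * ⟪v, S x⟫)
    have h4 := Real.exp_pos (ε * -⟪v, S x⟫)
    rcases abs_cases ⟪v, S x⟫ with ⟨h, -⟩ | ⟨h, -⟩ <;> rw [h] <;> linarith
  let e := stdOrthonormalBasis ℝ E
  refine (integrable_finsetSum Finset.univ fun i _ => (hdir (e i)).smul_const (e i)).congr
    (ae_of_all _ fun x => ?_)
  simp only [mul_smul, ← Finset.smul_sum, e.sum_repr']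

end ExpFamily

/-- For a minimal exponential family, the log-normalizer `A` is strictly convex on the
(convex) natural parameter set `Θ`, and consequently the mean map
`θ ↦ E_{p_θ}[S(x)]` is injective on the interior of `Θ` (a bijection between natural
and mean parameters). -/
theorem expFamily_minimal_strictConvex_meanMap_injective
    {𝒳 : Type*} [MeasurableSpace 𝒳] {d : ℕ}
    (ν : Measure 𝒳) [SigmaFinite ν]
    (S : 𝒳 → EuclideanSpace ℝ (Fin d)) (hS : Measurable S)
    (A : EuclideanSpace ℝ (Fin d) → ℝ)
    (hA : ∀ θ, A θ = Real.log (∫⁻ x, ENNReal.ofReal (Real.exp ⟪θ, S x⟫) ∂ν).toReal)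
    (Θset : Set (EuclideanSpace ℝ (Fin d)))
    (hΘ : Θset = {θ | (∫⁻ x, ENNReal.ofReal (Real.exp ⟪θ, S x⟫) ∂ν) < ⊤})
    (p : EuclideanSpace ℝ (Fin d) → Measure 𝒳)
    (hp : ∀ θ, p θ = ν.withDensity fun x => ENNReal.ofReal (Real.exp (⟪θ, S x⟫ - A θ)))
    (hminimal : ¬ ∃ φ : EuclideanSpace ℝ (Fin d), φ ≠ 0 ∧
      ∃ c : ℝ, ∀ᵐ x ∂ν, ⟪φ, S x⟫ = c) :
    Convex ℝ Θset ∧ StrictConvexOn ℝ Θset A ∧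
      Set.InjOn (fun θ => ∫ x, S x ∂(p θ)) (interior Θset) := by
  have hΘ' : Θset = {θ | Integrable (fun x => Real.exp ⟪θ, S x⟫) ν} := by
    simp only [hΘ, lintegral_exp_inner_lt_top_iff hS]
  have hA' : ∀ θ, A θ = Real.log (∫ x, Real.exp ⟪θ, S x⟫ ∂ν) := fun θ => by
    rw [hA, toReal_lintegral_exp_inner hS]
  have hconv : Convex ℝ Θset := hΘ' ▸ convex_setOf_integrable_exp_inner hS
  have hne : ∀ {θ η : EuclideanSpace ℝ (Fin d)}, θ ≠ η →
      ¬ ∃ c : ℝ, ∀ᵐ x ∂ν, ⟪θ - η, S x⟫ = c :=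
    fun h hc => hminimal ⟨_, sub_ne_zero.2 h, hc⟩
  have hν : ∀ {θ η : EuclideanSpace ℝ (Fin d)}, θ ≠ η → NeZero ν := by
    refine fun h => ⟨fun h0 => hne h ⟨0, ?_⟩⟩
    simp [h0]
  refine ⟨hconv, ⟨hconv, ?_⟩, ?_⟩
  · intro θ hθ η hη hθη a b ha hb hab
    have := hν hθη
    rw [hΘ'] at hθ hη
    simp only [hA', smul_eq_mul]
    exact log_integral_exp_inner_lt hS hθ hη (hne hθη) ha hb hab
  · intro θ hθ η hη hmean
    by_contra hθη
    have := hν hθη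
    have hmass : ∀ ξ ∈ interior Θset, ∫ x, Real.exp (⟪ξ, S x⟫ - A ξ) ∂ν = 1 := by
      intro ξ hξ
      have hξ' := interior_subset hξ
      rw [hΘ'] at hξ'
      rw [hA']
      exact integral_exp_inner_sub_log hξ'
    have hint : ∀ ξ ∈ interior Θset, Integrable (fun x => Real.exp (⟪ξ, S x⟫ - A ξ)) ν :=
      fun ξ hξ => Integrable.of_integral_ne_zero (by rw [hmass ξ hξ]; exact one_ne_zero)
    have hintS : ∀ ξ ∈ interior Θset,
        Integrable (fun x => Real.exp (⟪ξ, S x⟫ - A ξ) • S x) ν := by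
      intro ξ hξ
      rw [hΘ'] at hξ
      refine ((integrable_exp_inner_smul_of_mem_interior hS hξ).smul
        (Real.exp (A ξ))⁻¹).congr (ae_of_all _ fun x => ?_)
      simp only [Pi.smul_apply, Real.exp_sub, smul_smul, div_eq_inv_mul]
    have hp' : ∀ ξ, ∫ x, S x ∂(p ξ) = ∫ x, Real.exp (⟪ξ, S x⟫ - A ξ) • S x ∂ν := by
      intro ξ
      have hmeas : Measurable fun x => Real.exp (⟪ξ, S x⟫ - A ξ) :=
        Real.measurable_exp.comp ((Measurable.inner measurable_const hS).sub_const _)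
      rw [hp, integral_withDensity_eq_integral_toReal_smul hmeas.ennreal_ofReal
        (ae_of_all _ fun _ => ENNReal.ofReal_lt_top)]
      simp only [ENNReal.toReal_ofReal (Real.exp_pos _).le]
    simp only [hp'] at hmean
    exact hne hθη ⟨_, ae_inner_eq_of_integral_smul_eq (hint θ hθ) (hint η hη) (hintS θ hθ)
      (hintS η hη) ((hmass θ hθ).trans (hmass η hη).symm) hmean⟩
end

section
/- Let the likelihood be a minimal exponential family with log-normalizer A, and consider the conjugate-prior family with densities p(θ|η) ∝ exp(⟨η,T(θ)⟩), T(θ) = (θ,−A(θ)), on Θ ⊆ ℝ^d. Suppose there exist η₀ ∈ ℝ^{d+1} and δ₁, δ₂ > 0 such that: (1) for every η in the ball B(η₀,δ₁) the hypotheses guaranteeing a unique interior maximizer θ*_η of θ ↦ ⟨η,T(θ)⟩ hold; (2) the cone {kη' : k > 1, η' ∈ closure of B(η₀,δ₁)} lies entirely in the set of natural parameters with finite log-normalizer B; (3) A is differentiable of all orders; (4) there is P such that for all θ in ∪_{η' ∈ closure of B(η₀,δ₁)} B(θ*_{η'}, δ₂), all partial derivatives of A up to order 7 have magnitude bounded by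 P; (5) there is w > 0 such that det(∇²A(θ)) > w for all θ in that same set. Then there exist constants C and K such that for all k > K and all η ∈ B(η₀,δ₁), the covariance matrix of T(θ) under the distribution p(·|kη) has spectral norm less than C/k. -/
open MeasureTheory ENNReal

open Set Filter Topology in
/-- The Hessian of a convex function is nonnegative at interior points. -/
theorem ConvexOn.fderiv_fderiv_apply_self_nonneg {E : Type*} [NormedAddCommGroup E]
    [NormedSpace ℝ E] {s : Set E} {f : E → ℝ} (hf : ConvexOn ℝ s f) {x : E}
    (hx : x ∈ interior s) (hfx : ContDiffAt ℝ 2 f x) (v : E) :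
    0 ≤ fderiv ℝ (fderiv ℝ f) x v v := by
  let g : ℝ → E := fun t => x + t • v
  have hg : Continuous g := by fun_prop
  have hg' : ∀ t, HasDerivAt g v t := fun t => by
    simpa [g] using ((hasDerivAt_id t).smul_const v).const_add x
  have hev : ∀ᶠ y in 𝓝 x, y ∈ s ∧ DifferentiableAt ℝ f y := by
    filter_upwards [mem_interior_iff_mem_nhds.mp hx, hfx.eventually (by simp)] with y h1 h2
    exact ⟨h1, h2.differentiableAt (by simp)⟩
  have hev0 : ∀ᶠ t in 𝓝 (0 : ℝ), g t ∈ s ∧ DifferentiableAt ℝ f (g t) :=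
    (hg.tendsto' 0 x (by simp [g])).eventually hev
  obtain ⟨ε, hε, hball⟩ := Metric.eventually_nhds_iff_ball.mp hev0
  have hconv : ConvexOn ℝ (Metric.ball (0 : ℝ) ε) (f ∘ g) := by
    have h := (hf.comp_affineMap (AffineMap.lineMap (k := ℝ) x (x + v))).subset
      (s := Metric.ball (0 : ℝ) ε) (fun t ht => by
        simpa [AffineMap.lineMap_apply, g, add_comm] using (hball t ht).1) (convex_ball _ _)
    refine h.congr fun t _ => ?_
    simp [AffineMap.lineMap_apply, g, add_comm]
  have hderiv : ∀ t ∈ Metric.ball (0 : ℝ) ε,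
      HasDerivAt (f ∘ g) (fderiv ℝ f (g t) v) t := fun t ht =>
    (hball t ht).2.hasFDerivAt.comp_hasDerivAt t (hg' t)
  have hmono := hconv.monotoneOn_deriv fun t ht => (hderiv t ht).differentiableAt
  have h2 : HasDerivAt (fun t => fderiv ℝ f (g t) v) (fderiv ℝ (fderiv ℝ f) x v v) 0 := by
    have hd : DifferentiableAt ℝ (fderiv ℝ f) (g 0) := by
      simpa [g] using (hfx.fderiv_right (m := 1) (by norm_num)).differentiableAt (by simp)
    have := (hd.hasFDerivAt.comp_hasDerivAt (0 : ℝ) (hg' 0)).clm_apply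
      (hasDerivAt_const (0 : ℝ) v)
    simpa [g] using this
  refine h2.hasDerivWithinAt.nonneg_of_monotoneOn (s := Metric.ball 0 ε) ?_
    (hmono.congr fun t ht => (hderiv t ht).deriv)
  rw [accPt_iff_nhds]
  intro U hU
  obtain ⟨y, hy, hy0⟩ := (Filter.nonempty_of_mem (inter_mem_nhdsWithin {(0:ℝ)}ᶜ
    (inter_mem hU (Metric.ball_mem_nhds (0 : ℝ) hε))))
  exact ⟨y, ⟨hy0.1, hy0.2⟩, hy⟩

/-- A second-order Taylor lower bound along a segment. -/
theorem add_fderiv_add_le_of_le_fderiv_fderiv {E : Type*} [NormedAddCommGroup E]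
    [NormedSpace ℝ E] {f : E → ℝ} {x v : E} {c : ℝ}
    (hf : ∀ t ∈ Set.Icc (0 : ℝ) 1, ContDiffAt ℝ 2 f (x + t • v))
    (hc : ∀ t ∈ Set.Icc (0 : ℝ) 1, c ≤ fderiv ℝ (fderiv ℝ f) (x + t • v) v v) :
    f x + fderiv ℝ f x v + c / 2 ≤ f (x + v) := by
  let g : ℝ → E := fun t => x + t • v
  have hg' : ∀ t, HasDerivAt g v t := fun t => by
    simpa [g] using ((hasDerivAt_id t).smul_const v).const_add x
  have h1 : ∀ t ∈ Set.Icc (0 : ℝ) 1, HasDerivAt (fun t => f (g t)) (fderiv ℝ f (g t) v) t :=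
    fun t ht => ((hf t ht).differentiableAt (by simp)).hasFDerivAt.comp_hasDerivAt t (hg' t)
  have h2 : ∀ t ∈ Set.Icc (0 : ℝ) 1, HasDerivAt (fun t => fderiv ℝ f (g t) v)
      (fderiv ℝ (fderiv ℝ f) (g t) v v) t := fun t ht => by
    have hd : DifferentiableAt ℝ (fderiv ℝ f) (g t) :=
      ((hf t ht).fderiv_right (m := 1) (by norm_num)).differentiableAt (by simp)
    simpa using (hd.hasFDerivAt.comp_hasDerivAt t (hg' t)).clm_apply (hasDerivAt_const t v)
  have h3 : ∀ t ∈ Set.Icc (0 : ℝ) 1, HasDerivAt (fun t => fderiv ℝ f (g t) v - c * t)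
      (fderiv ℝ (fderiv ℝ f) (g t) v v - c) t := fun t ht => by
    refine ((h2 t ht).sub ((hasDerivAt_id t).const_mul c)).congr_deriv ?_
    simp
  have m1 : MonotoneOn (fun t => fderiv ℝ f (g t) v - c * t) (Set.Icc 0 1) :=
    monotoneOn_of_hasDerivWithinAt_nonneg (convex_Icc 0 1)
      (fun t ht => (h3 t ht).continuousAt.continuousWithinAt)
      (fun t ht => (h3 t (interior_subset ht)).hasDerivWithinAt)
      (fun t ht => sub_nonneg.mpr (hc t (interior_subset ht)))
  have h4 : ∀ t ∈ Set.Icc (0 : ℝ) 1,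
      HasDerivAt (fun t => f (g t) - fderiv ℝ f x v * t - c / 2 * t ^ 2)
        (fderiv ℝ f (g t) v - fderiv ℝ f x v - c * t) t := fun t ht => by
    have := ((h1 t ht).sub ((hasDerivAt_id t).const_mul (fderiv ℝ f x v))).sub
      (((hasDerivAt_id t).pow 2).const_mul (c / 2))
    refine this.congr_deriv ?_
    simp
    ring
  have m2 : MonotoneOn (fun t => f (g t) - fderiv ℝ f x v * t - c / 2 * t ^ 2)
      (Set.Icc 0 1) := by
    refine monotoneOn_of_hasDerivWithinAt_nonneg (convex_Icc 0 1)
      (fun t ht => (h4 t ht).continuousAt.continuousWithinAt)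
      (fun t ht => (h4 t (interior_subset ht)).hasDerivWithinAt) (fun t ht => ?_)
    have ht' := interior_subset ht
    have := m1 (by simp) ht' ht'.1
    simp [g] at this ⊢
    linarith
  have := m2 (by simp) (by simp) (zero_le_one' ℝ)
  simp [g] at this
  linarith

/-- A null vector of a positive semidefinite symmetric bilinear form lies in its radical. -/
theorem apply_eq_zero_of_apply_self_eq_zero {E : Type*} [NormedAddCommGroup E]
    [NormedSpace ℝ E] {B : E →L[ℝ] E →L[ℝ] ℝ} (hsymm : ∀ u v, B u v = B v u)
    (hnn : ∀ u, 0 ≤ B u u) {v : E} (hv : B v v = 0) (u : E) : B v u = 0 := by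
  have key : ∀ t : ℝ, 0 ≤ 2 * t * B v u + t ^ 2 * B u u := fun t => by
    have := hnn (v + t • u)
    simp [hv, hsymm u v] at this
    linarith
  have hu := hnn u
  have h := key (-(B v u) / (1 + B u u))
  have h1 : 2 * (-(B v u) / (1 + B u u)) * B v u + (-(B v u) / (1 + B u u)) ^ 2 * B u u
      = -(B v u ^ 2 * ((2 + B u u) / (1 + B u u) ^ 2)) := by
    field_simp
    ring
  rw [h1] at h
  have h2 : 0 < (2 + B u u) / (1 + B u u) ^ 2 := by positivity
  by_contra hne
  have : 0 < B v u ^ 2 * ((2 + B u u) / (1 + B u u) ^ 2) := by positivity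
  linarith

/-- Positive semidefinite symmetric bilinear forms of bounded norm whose Gram determinant is
bounded below are uniformly coercive. -/
theorem exists_forall_mul_sq_norm_le_apply_self {d : ℕ} (P : ℝ) {w : ℝ} (hw : 0 < w) :
    ∃ m > 0, ∀ B : (Fin d → ℝ) →L[ℝ] (Fin d → ℝ) →L[ℝ] ℝ, ‖B‖ ≤ P →
      (∀ u v, B u v = B v u) → (∀ u, 0 ≤ B u u) →
      w ≤ (Matrix.of fun i j : Fin d => B (Pi.single i 1) (Pi.single j 1)).det →
      ∀ v, m * ‖v‖ ^ 2 ≤ B v v := by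
  have : ProperSpace ((Fin d → ℝ) →L[ℝ] (Fin d → ℝ) →L[ℝ] ℝ) :=
    FiniteDimensional.proper ℝ ((Fin d → ℝ) →L[ℝ] (Fin d → ℝ) →L[ℝ] ℝ)
  let Q : Set ((Fin d → ℝ) →L[ℝ] (Fin d → ℝ) →L[ℝ] ℝ) := Metric.closedBall 0 P ∩
    ({B | ∀ u v, B u v = B v u} ∩ ({B | ∀ u, 0 ≤ B u u} ∩
      {B | w ≤ (Matrix.of fun i j : Fin d => B (Pi.single i 1) (Pi.single j 1)).det}))
  have hQ : IsCompact Q := by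
    refine (isCompact_closedBall 0 P).inter_right (IsClosed.inter ?_ (IsClosed.inter ?_ ?_))
    · simp only [Set.ofPred_forall]
      exact isClosed_iInter fun u => isClosed_iInter fun v =>
        isClosed_eq (by fun_prop) (by fun_prop)
    · simp only [Set.ofPred_forall]
      exact isClosed_iInter fun u => isClosed_le (by fun_prop) (by fun_prop)
    · refine isClosed_le (by fun_prop) (Continuous.matrix_det ?_)
      refine continuous_pi fun i => continuous_pi fun j => ?_
      simp only [Matrix.of_apply]
      fun_prop
  have hK := hQ.prod (isCompact_sphere (0 : Fin d → ℝ) 1)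
  have hpos : ∀ p ∈ Q ×ˢ Metric.sphere (0 : Fin d → ℝ) 1, 0 < p.1 p.2 p.2 := by
    rintro ⟨B, v⟩ ⟨⟨-, hs, hn, hd⟩, hv⟩
    refine lt_of_le_of_ne (hn v) fun h0 => ?_
    have hrad := apply_eq_zero_of_apply_self_eq_zero hs hn h0.symm
    have hv0 : v ≠ 0 := by
      rintro rfl
      simp at hv
    have hdet0 := (Matrix.exists_mulVec_eq_zero_iff
      (M := Matrix.of fun i j : Fin d => B (Pi.single i 1) (Pi.single j 1))).mp ⟨v, hv0, by
        ext i
        have h1 : v = ∑ j, v j • (Pi.single j 1 : Fin d → ℝ) := by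
          simpa using (pi_eq_sum_univ' v)
        have h2 : B (Pi.single i 1) v = 0 := by rw [hs, hrad]
        rw [h1] at h2
        simpa [Matrix.mulVec, dotProduct, mul_comm] using h2⟩
    simp only [Set.mem_ofPred_eq] at hd
    linarith
  obtain ⟨m, hm, hmle⟩ : ∃ m > 0, ∀ p ∈ Q ×ˢ Metric.sphere (0 : Fin d → ℝ) 1,
      m ≤ p.1 p.2 p.2 := by
    rcases (Q ×ˢ Metric.sphere (0 : Fin d → ℝ) 1).eq_empty_or_nonempty with he | hne
    · exact ⟨1, one_pos, by simp [he]⟩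
    · obtain ⟨p, hp, hmin⟩ := hK.exists_isMinOn hne
        (f := fun p : ((Fin d → ℝ) →L[ℝ] (Fin d → ℝ) →L[ℝ] ℝ) × (Fin d → ℝ) => p.1 p.2 p.2)
        (by fun_prop)
      exact ⟨_, hpos p hp, fun q hq => hmin hq⟩
  refine ⟨m, hm, fun B hP hs hn hd v => ?_⟩
  rcases eq_or_ne v 0 with rfl | hv
  · simp
  have hv' : 0 < ‖v‖ := norm_pos_iff.mpr hv
  have h := hmle (B, ‖v‖⁻¹ • v) ⟨⟨(dist_zero_right B).le.trans hP, hs, hn, hd⟩, by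
    simp [norm_smul, hv'.ne']⟩
  simp only [map_smul, smul_apply, smul_eq_mul] at h
  calc m * ‖v‖ ^ 2 ≤ (‖v‖⁻¹ * (‖v‖⁻¹ * B v v)) * ‖v‖ ^ 2 := by gcongr
    _ = B v v := by field_simp

/-- A nonnegative convex function growing quadratically near an interior zero dominates the
squared norm up to its own square. -/
theorem ConvexOn.sq_norm_sub_le {E : Type*} [NormedAddCommGroup E] [NormedSpace ℝ E]
    {s : Set E} {h : E → ℝ} (hh : ConvexOn ℝ s h) {x : E} (hx : x ∈ interior s) (hhx : h x = 0)
    {c δ : ℝ} (hc : 0 < c) (hδ : 0 < δ)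
    (hloc : ∀ y ∈ interior s, ‖y - x‖ < δ → c * ‖y - x‖ ^ 2 ≤ h y) {y : E} (hy : y ∈ s)
    (hhy : 0 ≤ h y) :
    ‖y - x‖ ^ 2 ≤ (2 / c + 4 / (c ^ 2 * δ ^ 2)) * (h y + h y ^ 2) := by
  have key : ∀ t : ℝ, 0 ≤ t → t < 1 → t * ‖y - x‖ < δ → c * (t * ‖y - x‖) ^ 2 ≤ t * h y := by
    intro t ht0 ht1 htδ
    have hz := hh.1.combo_interior_self_mem_interior hx hy
      (by linarith : 0 < 1 - t) ht0 (by ring)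
    have hsub : (1 - t) • x + t • y - x = t • (y - x) := by module
    have hn : ‖(1 - t) • x + t • y - x‖ = t * ‖y - x‖ := by
      rw [hsub, norm_smul, Real.norm_of_nonneg ht0]
    have h1 := hloc _ hz (by rwa [hn])
    have h2 := hh.2 (interior_subset hx) hy (by linarith : 0 ≤ 1 - t) ht0 (by ring)
    rw [hn] at h1
    simp only [hhx, smul_eq_mul, mul_zero, zero_add] at h2
    exact h1.trans h2
  have hexp : (2 / c + 4 / (c ^ 2 * δ ^ 2)) * (h y + h y ^ 2) =
      2 / c * h y + 4 / (c ^ 2 * δ ^ 2) * h y ^ 2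
        + (2 / c * h y ^ 2 + 4 / (c ^ 2 * δ ^ 2) * h y) := by ring
  have p1 : 0 ≤ 2 / c * h y ^ 2 + 4 / (c ^ 2 * δ ^ 2) * h y := by positivity
  rcases lt_or_ge ‖y - x‖ δ with hlt | hge
  · have := key (1 / 2) (by norm_num) (by norm_num) (by linarith [norm_nonneg (y - x)])
    have h2 : ‖y - x‖ ^ 2 ≤ 2 / c * h y := by
      rw [div_mul_eq_mul_div, le_div_iff₀ hc]
      linarith
    have : 0 ≤ 4 / (c ^ 2 * δ ^ 2) * h y ^ 2 := by positivity
    linarith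
  · have hpos : 0 < ‖y - x‖ := hδ.trans_le hge
    have heq : δ / (2 * ‖y - x‖) * ‖y - x‖ = δ / 2 := by field_simp
    have := key (δ / (2 * ‖y - x‖)) (by positivity)
      (by rw [div_lt_one (by positivity)]; linarith) (by rw [heq]; linarith)
    rw [heq] at this
    have h2 : ‖y - x‖ ≤ 2 / (c * δ) * h y := by
      rw [div_mul_eq_mul_div, le_div_iff₀ (by positivity)] at this ⊢
      nlinarith
    have h3 : ‖y - x‖ ^ 2 ≤ 4 / (c ^ 2 * δ ^ 2) * h y ^ 2 := by
      calc ‖y - x‖ ^ 2 ≤ (2 / (c * δ) * h y) ^ 2 := by gcongr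
        _ = _ := by ring
    have : 0 ≤ 2 / c * h y := by positivity
    linarith

/-- The log-Laplace transform is convex on its domain of finiteness. -/
theorem convexOn_log_lintegral_exp {𝒳 : Type*} [MeasurableSpace 𝒳] {d : ℕ} (ν : Measure 𝒳)
    {S : 𝒳 → Fin d → ℝ} (hS : Measurable S) {Z : (Fin d → ℝ) → ℝ≥0∞}
    (hZ : ∀ θ, Z θ = ∫⁻ x, ENNReal.ofReal (Real.exp (∑ i, θ i * S x i)) ∂ν) :
    ConvexOn ℝ {θ | Z θ < ⊤} fun θ => Real.log (Z θ).toReal := by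
  have hm : ∀ θ : Fin d → ℝ, Measurable fun x => ENNReal.ofReal (Real.exp (∑ i, θ i * S x i)) :=
    fun θ => by
      have : ∀ i, Measurable fun x => S x i := fun i => (measurable_pi_apply i).comp hS
      fun_prop
  have holder : ∀ θ₁ θ₂ : Fin d → ℝ, ∀ a b : ℝ, 0 ≤ a → 0 ≤ b → a + b = 1 →
      Z (a • θ₁ + b • θ₂) ≤ Z θ₁ ^ a * Z θ₂ ^ b := by
    intro θ₁ θ₂ a b ha hb hab
    rw [hZ, hZ θ₁, hZ θ₂]
    refine le_trans (le_of_eq ?_) (ENNReal.lintegral_mul_norm_pow_le (hm θ₁).aemeasurable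
      (hm θ₂).aemeasurable ha hb hab)
    refine lintegral_congr fun x => ?_
    rw [ENNReal.ofReal_rpow_of_pos (Real.exp_pos _), ENNReal.ofReal_rpow_of_pos (Real.exp_pos _),
      ← ENNReal.ofReal_mul (by positivity), ← Real.exp_mul, ← Real.exp_mul, ← Real.exp_add]
    congr 2
    simp only [Pi.add_apply, Pi.smul_apply, smul_eq_mul, Finset.sum_mul]
    rw [← Finset.sum_add_distrib]
    exact Finset.sum_congr rfl fun i _ => by ring
  have hfin : ∀ θ₁ θ₂ : Fin d → ℝ, ∀ a b : ℝ, 0 ≤ a → 0 ≤ b → Z θ₁ < ⊤ → Z θ₂ < ⊤ →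
      Z θ₁ ^ a * Z θ₂ ^ b < ⊤ := fun θ₁ θ₂ a b ha hb h1 h2 =>
    ENNReal.mul_lt_top (ENNReal.rpow_lt_top_of_nonneg ha h1.ne)
      (ENNReal.rpow_lt_top_of_nonneg hb h2.ne)
  refine ⟨fun θ₁ h1 θ₂ h2 a b ha hb hab => (holder θ₁ θ₂ a b ha hb hab).trans_lt
    (hfin θ₁ θ₂ a b ha hb h1 h2), fun θ₁ h1 θ₂ h2 a b ha hb hab => ?_⟩
  rcases eq_or_ne ν 0 with rfl | hν
  · simp [hZ]
  have hpos : ∀ θ, Z θ ≠ 0 := fun θ h0 => by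
    rw [hZ, lintegral_eq_zero_iff (hm θ)] at h0
    refine hν (Measure.measure_univ_eq_zero.mp ?_)
    refine measure_mono_null (fun x _ => ?_) (ae_iff.mp h0)
    simp [Real.exp_pos]
  have h1' := ENNReal.toReal_pos (hpos θ₁) (ne_of_lt h1)
  have h2' := ENNReal.toReal_pos (hpos θ₂) (ne_of_lt h2)
  have hle := ENNReal.toReal_mono (hfin θ₁ θ₂ a b ha hb h1 h2).ne (holder θ₁ θ₂ a b ha hb hab)
  have h3 : (Z (a • θ₁ + b • θ₂)).toReal > 0 := ENNReal.toReal_pos (hpos _)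
    ((holder θ₁ θ₂ a b ha hb hab).trans_lt (hfin θ₁ θ₂ a b ha hb h1 h2)).ne
  rw [ENNReal.toReal_mul, ← ENNReal.toReal_rpow, ← ENNReal.toReal_rpow] at hle
  refine (Real.log_le_log h3 hle).trans (le_of_eq ?_)
  rw [Real.log_mul (by positivity) (by positivity), Real.log_rpow h1', Real.log_rpow h2']
  simp

/-- The Laplace transform of an s-finite measure is measurable. -/
theorem measurable_lintegral_exp {𝒳 : Type*} [MeasurableSpace 𝒳] {d : ℕ} (ν : Measure 𝒳)
    [SFinite ν] {S : 𝒳 → Fin d → ℝ} (hS : Measurable S) :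
    Measurable fun θ : Fin d → ℝ =>
      ∫⁻ x, ENNReal.ofReal (Real.exp (∑ i, θ i * S x i)) ∂ν := by
  refine Measurable.lintegral_prod_right'
    (f := fun p : (Fin d → ℝ) × 𝒳 => ENNReal.ofReal (Real.exp (∑ i, p.1 i * S p.2 i))) ?_
  have : ∀ i, Measurable fun p : (Fin d → ℝ) × 𝒳 => S p.2 i := fun i =>
    (measurable_pi_apply i).comp (hS.comp measurable_snd)
  fun_prop

/-- Halving the exponent of a log-concave density costs at most a factor `2 ^ d`. -/
theorem ConvexOn.setIntegral_exp_half_le {d : ℕ} {s : Set (Fin d → ℝ)} {h : (Fin d → ℝ) → ℝ}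
    (hh : ConvexOn ℝ s h) (hs : MeasurableSet s) {x : Fin d → ℝ} (hx : x ∈ s) (hhx : h x = 0)
    {k : ℝ} (hk : 0 ≤ k) (hexp_int : IntegrableOn (fun θ => Real.exp (-(k * h θ))) s)
    (hexp_int2 : IntegrableOn (fun θ => Real.exp (-(k * h θ / 2))) s) :
    ∫ θ in s, Real.exp (-(k * h θ / 2)) ≤ 2 ^ d * ∫ θ in s, Real.exp (-(k * h θ)) := by
  set F : (Fin d → ℝ) → ℝ := s.indicator fun θ => Real.exp (-(k * h θ)) with hF
  have hFnn : ∀ θ, 0 ≤ F θ := fun θ => Set.indicator_nonneg (fun _ _ => (Real.exp_pos _).le) θ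
  have hFint : Integrable F := (integrable_indicator_iff hs).mpr hexp_int
  have hFint' : Integrable fun θ => F ((1 / 2 : ℝ) • θ + (1 / 2 : ℝ) • x) :=
    (hFint.comp_add_right ((1 / 2 : ℝ) • x)).comp_smul (by norm_num : (1 / 2 : ℝ) ≠ 0)
  rw [← integral_indicator hs, ← integral_indicator hs, ← hF]
  have hchange : ∫ θ, F ((1 / 2 : ℝ) • θ + (1 / 2 : ℝ) • x) = 2 ^ d * ∫ θ, F θ := by
    rw [Measure.integral_comp_smul volume (fun θ => F (θ + (1 / 2 : ℝ) • x)) (1 / 2),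
      integral_add_right_eq_self]
    simp
  rw [← hchange]
  refine integral_mono ((integrable_indicator_iff hs).mpr hexp_int2) hFint' fun θ => ?_
  by_cases hθ : θ ∈ s
  · have hmem := hh.1 hθ hx (by norm_num : (0 : ℝ) ≤ 1 / 2)
      (by norm_num : (0 : ℝ) ≤ 1 / 2) (by norm_num)
    have hle := hh.2 hθ hx (by norm_num : (0 : ℝ) ≤ 1 / 2)
      (by norm_num : (0 : ℝ) ≤ 1 / 2) (by norm_num)
    simp only [hhx, smul_eq_mul, mul_zero, add_zero] at hle
    simp only [hF, Set.indicator_of_mem hθ, Set.indicator_of_mem hmem]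
    refine Real.exp_le_exp.mpr ?_
    nlinarith
  · simpa [Set.indicator_of_notMem hθ] using hFnn _

theorem add_sq_mul_exp_neg_le {k h : ℝ} (hk : 1 ≤ k) (hh : 0 ≤ h) :
    (h + h ^ 2) * Real.exp (-(k * h)) ≤ 10 / k * Real.exp (-(k * h / 2)) := by
  have hk0 : 0 < k := by linarith
  have hq := Real.quadratic_le_exp_of_nonneg (x := k * h / 2) (by positivity)
  have h1 : k * (h + h ^ 2) ≤ 10 * Real.exp (k * h / 2) := by
    have : 0 ≤ k * h := by positivity
    nlinarith [sq_nonneg h, mul_nonneg (sub_nonneg.mpr hk) (mul_nonneg hk0.le (sq_nonneg h))]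
  have h2 : Real.exp (-(k * h / 2)) = Real.exp (k * h / 2) * Real.exp (-(k * h)) := by
    rw [← Real.exp_add]
    ring_nf
  rw [h2, ← mul_assoc, div_mul_eq_mul_div]
  refine mul_le_mul_of_nonneg_right ?_ (Real.exp_pos _).le
  rw [le_div_iff₀ hk0]
  linarith

/-- Covariances with respect to a probability density are bounded by second moments about
arbitrary centres. -/
theorem abs_integral_sub_mul_sub_mul_le {α : Type*} [MeasurableSpace α] {μ : Measure α}
    {ρ X Y : α → ℝ} (hρ : Integrable ρ μ) (hρ0 : ∀ x, 0 ≤ ρ x) (hρ1 : ∫ x, ρ x ∂μ = 1)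
    (hX : Measurable X) (hY : Measurable Y) {a b ε : ℝ}
    (hXi : Integrable (fun x => (X x - a) ^ 2 * ρ x) μ)
    (hYi : Integrable (fun x => (Y x - b) ^ 2 * ρ x) μ)
    (hXε : ∫ x, (X x - a) ^ 2 * ρ x ∂μ ≤ ε) (hYε : ∫ x, (Y x - b) ^ 2 * ρ x ∂μ ≤ ε) :
    |∫ x, (X x - ∫ y, X y * ρ y ∂μ) * (Y x - ∫ y, Y y * ρ y ∂μ) * ρ x ∂μ| ≤ ε := by
  have variance : ∀ {W : α → ℝ} {c : ℝ}, Measurable W →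
      Integrable (fun x => (W x - c) ^ 2 * ρ x) μ → ∫ x, (W x - c) ^ 2 * ρ x ∂μ ≤ ε →
      Integrable (fun x => (W x - ∫ y, W y * ρ y ∂μ) ^ 2 * ρ x) μ ∧
        ∫ x, (W x - ∫ y, W y * ρ y ∂μ) ^ 2 * ρ x ∂μ ≤ ε := by
    intro W c hW hi hε
    have h1 : Integrable (fun x => (W x - c) * ρ x) μ := by
      refine (hρ.add hi).mono' ((hW.sub_const c).aestronglyMeasurable.mul hρ.1)
        (Filter.Eventually.of_forall fun x => ?_)
      rw [Real.norm_eq_abs, abs_mul, abs_of_nonneg (hρ0 x)]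
      have : |W x - c| ≤ 1 + (W x - c) ^ 2 := by
        rw [← sq_abs (W x - c)]
        nlinarith [sq_nonneg (|W x - c| - 1 / 2)]
      simp only [Pi.add_apply]
      nlinarith [mul_le_mul_of_nonneg_right this (hρ0 x)]
    set m := ∫ y, W y * ρ y ∂μ with hm
    have h2 : ∫ x, (W x - c) * ρ x ∂μ = m - c := by
      have hW' : Integrable (fun x => W x * ρ x) μ := by
        refine (h1.add (hρ.const_mul c)).congr (Filter.Eventually.of_forall fun x => ?_)
        simp only [Pi.add_apply]
        ring
      simp_rw [sub_mul]
      rw [integral_sub hW' (hρ.const_mul c), integral_const_mul, hρ1, mul_one]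
    have hexp : ∀ x, (W x - m) ^ 2 * ρ x =
        (W x - c) ^ 2 * ρ x - 2 * (m - c) * ((W x - c) * ρ x) + (m - c) ^ 2 * ρ x :=
      fun x => by ring
    have i1 : Integrable
        (fun x => (W x - c) ^ 2 * ρ x - 2 * (m - c) * ((W x - c) * ρ x)) μ :=
      hi.sub (h1.const_mul (2 * (m - c)))
    have i2 := hρ.const_mul ((m - c) ^ 2)
    simp_rw [hexp]
    refine ⟨i1.add i2, ?_⟩
    rw [integral_add i1 i2, integral_sub hi (h1.const_mul _), integral_const_mul,
      integral_const_mul, h2, hρ1]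
    nlinarith [sq_nonneg (m - c)]
  obtain ⟨iX, vX⟩ := variance hX hXi hXε
  obtain ⟨iY, vY⟩ := variance hY hYi hYε
  set p := ∫ y, X y * ρ y ∂μ
  set q := ∫ y, Y y * ρ y ∂μ
  have hbound : ∀ x, ‖(X x - p) * (Y x - q) * ρ x‖ ≤
      ((X x - p) ^ 2 * ρ x + (Y x - q) ^ 2 * ρ x) / 2 := fun x => by
    rw [norm_mul, Real.norm_of_nonneg (hρ0 x), Real.norm_eq_abs, abs_mul]
    have : |X x - p| * |Y x - q| ≤ ((X x - p) ^ 2 + (Y x - q) ^ 2) / 2 := by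
      rw [← sq_abs (X x - p), ← sq_abs (Y x - q)]
      nlinarith [sq_nonneg (|X x - p| - |Y x - q|)]
    nlinarith [mul_le_mul_of_nonneg_right this (hρ0 x)]
  have := norm_integral_le_of_norm_le ((iX.add iY).div_const 2)
    (Filter.Eventually.of_forall hbound)
  rw [integral_div] at this
  simp only [Pi.add_apply] at this
  rw [integral_add iX iY] at this
  exact this.trans (by linarith)

/-- A matrix with entries bounded by `ε` has spectral norm at most `n * ε`. -/
theorem Matrix.sqrt_sum_sq_mulVec_le {n : ℕ} {M : Matrix (Fin n) (Fin n) ℝ} {ε : ℝ} (hε : 0 ≤ ε)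
    (hM : ∀ i j, |M i j| ≤ ε) (v : Fin n → ℝ) :
    √(∑ i, (M.mulVec v i) ^ 2) ≤ n * ε * √(∑ i, (v i) ^ 2) := by
  rw [← Real.sqrt_sq (by positivity : 0 ≤ n * ε), ← Real.sqrt_mul (sq_nonneg _)]
  refine Real.sqrt_le_sqrt ?_
  have hrow : ∀ i, (M.mulVec v i) ^ 2 ≤ (n * ε ^ 2) * ∑ j, (v j) ^ 2 := fun i => by
    refine (Finset.sum_mul_sq_le_sq_mul_sq Finset.univ (fun j => M i j) v).trans ?_
    refine mul_le_mul_of_nonneg_right ?_ (by positivity)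
    refine (Finset.sum_le_card_nsmul _ _ (ε ^ 2) fun j _ => ?_).trans (by simp)
    exact sq_le_sq' (neg_le_of_abs_le (hM i j)) (le_of_abs_le (hM i j))
  refine (Finset.sum_le_card_nsmul _ _ _ fun i _ => hrow i).trans (le_of_eq ?_)
  simp
  ring

open Topology in
/-- A concave-minus-linear objective with a strict interior maximizer has positive weight on the
convex part. -/
theorem ConvexOn.pos_of_strict_max {E : Type*} [NormedAddCommGroup E] [NormedSpace ℝ E]
    [Nontrivial E] {s : Set E} {f : E → ℝ} (hf : ConvexOn ℝ s f) {x : E} (hx : x ∈ interior s)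
    {ℓ : E →L[ℝ] ℝ} {a : ℝ} (hmax : ∀ y ∈ s, y ≠ x → ℓ y - a * f y < ℓ x - a * f x) : 0 < a := by
  by_contra! ha
  obtain ⟨e, he⟩ := exists_ne (0 : E)
  have h1 : ∀ᶠ t in 𝓝 (0 : ℝ), x + t • e ∈ s :=
    ((by fun_prop : Continuous fun t : ℝ => x + t • e).tendsto' 0 x (by simp)).eventually
      (mem_interior_iff_mem_nhds.mp hx)
  have h2 : ∀ᶠ t in 𝓝 (0 : ℝ), x - t • e ∈ s :=
    ((by fun_prop : Continuous fun t : ℝ => x - t • e).tendsto' 0 x (by simp)).eventually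
      (mem_interior_iff_mem_nhds.mp hx)
  obtain ⟨t, ⟨ht1, ht2⟩, ht0⟩ :=
    (((h1.and h2).filter_mono nhdsWithin_le_nhds).and
      (self_mem_nhdsWithin : {(0 : ℝ)}ᶜ ∈ 𝓝[≠] (0 : ℝ))).exists
  have hte : t • e ≠ 0 := smul_ne_zero ht0 he
  have m1 := hmax _ ht1 (by simpa using hte)
  have m2 := hmax _ ht2 (by simpa using hte)
  have hc := hf.2 ht1 ht2 (by norm_num : (0 : ℝ) ≤ 1 / 2) (by norm_num : (0 : ℝ) ≤ 1 / 2)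
    (by norm_num)
  have hmid : (1 / 2 : ℝ) • (x + t • e) + (1 / 2 : ℝ) • (x - t • e) = x := by module
  rw [hmid] at hc
  simp only [smul_eq_mul] at hc
  rw [map_add] at m1
  rw [map_sub] at m2
  nlinarith [mul_le_mul_of_nonneg_left hc (neg_nonneg.mpr ha)]

/-- The gap below a reference value of a concave objective `ℓ - a • f` is convex. -/
theorem ConvexOn.const_sub_clm_sub_mul {E : Type*} [NormedAddCommGroup E] [NormedSpace ℝ E]
    {s : Set E} {f : E → ℝ} (hf : ConvexOn ℝ s f) (ℓ : E →L[ℝ] ℝ) {a : ℝ} (ha : 0 ≤ a) (b : ℝ) :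
    ConvexOn ℝ s fun y => b - (ℓ y - a * f y) := by
  refine ((((-ℓ).toLinearMap.convexOn hf.1).add (hf.smul ha)).add_const b).congr fun y _ => ?_
  simp
  ring

open Topology in
/-- Around an interior maximizer of `ℓ - a • f`, where the Hessian of `f` is coercive near the
maximizer, the gap in the objective controls the squared distance to the maximizer. -/
theorem ConvexOn.sq_norm_sub_le_gap {E : Type*} [NormedAddCommGroup E] [NormedSpace ℝ E]
    {s : Set E} {f : E → ℝ} (hf : ConvexOn ℝ s f)
    (hsmooth : ∀ y ∈ interior s, ContDiffAt ℝ 2 f y) {x : E} (hx : x ∈ interior s)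
    {ℓ : E →L[ℝ] ℝ} {a a₀ m δ : ℝ} (ha₀ : 0 < a₀) (ha : a₀ ≤ a) (hm : 0 < m) (hδ : 0 < δ)
    (hmax : ∀ y ∈ s, ℓ y - a * f y ≤ ℓ x - a * f x)
    (hcoer : ∀ y ∈ interior s, ‖y - x‖ < δ → ∀ v, m * ‖v‖ ^ 2 ≤ fderiv ℝ (fderiv ℝ f) y v v)
    {y : E} (hy : y ∈ s) :
    ‖y - x‖ ^ 2 ≤ (2 / (a₀ * m / 2) + 4 / ((a₀ * m / 2) ^ 2 * δ ^ 2)) *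
      ((ℓ x - a * f x - (ℓ y - a * f y)) + (ℓ x - a * f x - (ℓ y - a * f y)) ^ 2) := by
  have ha' : 0 < a := ha₀.trans_le ha
  refine (hf.const_sub_clm_sub_mul ℓ ha'.le _).sq_norm_sub_le hx (by simp) (by positivity)
    hδ (fun z hz hzδ => ?_) hy
    (sub_nonneg.mpr (hmax y hy))
  have hseg : ∀ t ∈ Set.Icc (0 : ℝ) 1, x + t • (z - x) ∈ interior s := fun t ht =>
    hf.1.interior.add_smul_sub_mem hx hz ht
  have htaylor := add_fderiv_add_le_of_le_fderiv_fderiv (f := f) (x := x) (v := z - x)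
    (c := m * ‖z - x‖ ^ 2) (fun t ht => hsmooth _ (hseg t ht)) (fun t ht => by
      refine hcoer _ (hseg t ht) ?_ _
      rw [add_sub_cancel_left, norm_smul, Real.norm_of_nonneg ht.1]
      exact (mul_le_of_le_one_left (norm_nonneg _) ht.2).trans_lt hzδ)
  have hcrit : ℓ (z - x) = a * fderiv ℝ f x (z - x) := by
    have hloc : IsLocalMax (fun y => ℓ y - a * f y) x := by
      filter_upwards [mem_interior_iff_mem_nhds.mp hx] with y hy using hmax y hy
    have hd : HasFDerivAt (fun y => ℓ y - a * f y) (ℓ - a • fderiv ℝ f x) x :=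
      ℓ.hasFDerivAt.sub
        (((hsmooth x hx).differentiableAt (by simp)).hasFDerivAt.const_mul a)
    have := congrArg (fun L : E →L[ℝ] ℝ => L (z - x)) (hloc.hasFDerivAt_eq_zero hd)
    simpa [sub_eq_zero] using this
  rw [add_sub_cancel] at htaylor
  rw [map_sub] at hcrit
  have h1 := mul_le_mul_of_nonneg_left htaylor ha'.le
  have h2 : a₀ * (m * ‖z - x‖ ^ 2) ≤ a * (m * ‖z - x‖ ^ 2) := by gcongr
  nlinarith

/-- The gap `⟪η, T θ*⟫ - ⟪η, T θ⟫` of the conjugate-prior log-density is convex and controls the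
deviation of the sufficient statistics `T θ = (θ, -A θ)` from `T θ*`, uniformly in `η`. -/
theorem exists_forall_sq_snoc_sub_le {d : ℕ} {A : (Fin d → ℝ) → ℝ} {Θset : Set (Fin d → ℝ)}
    (hconv : ConvexOn ℝ Θset A)
    {ip : (Fin (d + 1) → ℝ) → (Fin d → ℝ) → ℝ}
    (hip : ∀ η θ, ip η θ = (∑ i : Fin d, η i.castSucc * θ i) - η (Fin.last d) * A θ)
    {η₀ : Fin (d + 1) → ℝ} {δ₁ δ₂ : ℝ} (hδ₁ : 0 < δ₁) (hδ₂ : 0 < δ₂)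
    {θstar : (Fin (d + 1) → ℝ) → Fin d → ℝ}
    (hθstar : ∀ η' ∈ closure (Metric.ball η₀ δ₁),
      θstar η' ∈ interior Θset ∧
        ∀ θ ∈ Θset, θ ≠ θstar η' → ip η' θ < ip η' (θstar η'))
    (hAsmooth : ContDiffOn ℝ (⊤ : ℕ∞) A (interior Θset))
    (hbound : ∃ P : ℝ, ∀ η' ∈ closure (Metric.ball η₀ δ₁),
      ∀ θ ∈ Metric.ball (θstar η') δ₂, ‖iteratedFDeriv ℝ 2 A θ‖ ≤ P)
    (hdet : ∃ w > 0, ∀ η' ∈ closure (Metric.ball η₀ δ₁),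
      ∀ θ ∈ Metric.ball (θstar η') δ₂,
        w < Matrix.det (Matrix.of fun i j : Fin d =>
          iteratedFDeriv ℝ 2 A θ ![Pi.single i 1, Pi.single j 1])) :
    ∃ C, 0 ≤ C ∧ ∀ η ∈ closure (Metric.ball η₀ δ₁),
      ConvexOn ℝ Θset (fun θ => ip η (θstar η) - ip η θ) ∧ ∀ θ ∈ Θset, ∀ i : Fin (d + 1),
      ((Fin.snoc θ (-(A θ)) : Fin (d + 1) → ℝ) i -
        (Fin.snoc (θstar η) (-(A (θstar η))) : Fin (d + 1) → ℝ) i) ^ 2 ≤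
        C * ((ip η (θstar η) - ip η θ) + (ip η (θstar η) - ip η θ) ^ 2) := by
  rcases Nat.eq_zero_or_pos d with rfl | hd
  · refine ⟨0, le_rfl, fun η _ => ⟨⟨hconv.1, fun θ₁ _ θ₂ _ a b _ _ _ => ?_⟩, fun θ _ i => ?_⟩⟩
    · simp [Subsingleton.elim _ (θstar η)]
    · simp [Subsingleton.elim θ (θstar η)]
  have : NeZero d := ⟨hd.ne'⟩
  obtain ⟨P, hP⟩ := hbound
  obtain ⟨w, hw, hdet⟩ := hdet
  obtain ⟨m, hm, hcoer⟩ := exists_forall_mul_sq_norm_le_apply_self (d := d) P hw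
  have hsmooth : ∀ y ∈ interior Θset, ContDiffAt ℝ 2 A y := fun y hy =>
    ((hAsmooth y hy).contDiffAt (isOpen_interior.mem_nhds hy)).of_le
      (WithTop.coe_le_coe.mpr (le_top : (2 : ℕ∞) ≤ ⊤))
  let ℓ : (Fin (d + 1) → ℝ) → (Fin d → ℝ) →L[ℝ] ℝ := fun η =>
    ∑ i : Fin d, η i.castSucc • ContinuousLinearMap.proj i
  have hip' : ∀ η θ, ip η θ = ℓ η θ - η (Fin.last d) * A θ := fun η θ => by
    simp [hip, ℓ]
  have hmax : ∀ η ∈ closure (Metric.ball η₀ δ₁), ∀ θ ∈ Θset, ip η θ ≤ ip η (θstar η) := by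
    intro η hη θ hθ
    rcases eq_or_ne θ (θstar η) with rfl | hne
    · rfl
    · exact ((hθstar η hη).2 θ hθ hne).le
  have hpos : ∀ η ∈ closure (Metric.ball η₀ δ₁), 0 < η (Fin.last d) := fun η hη =>
    hconv.pos_of_strict_max (hθstar η hη).1 (ℓ := ℓ η) fun y hy hne => by
      simpa only [hip'] using (hθstar η hη).2 y hy hne
  have hcl : closure (Metric.ball η₀ δ₁) = Metric.closedBall η₀ δ₁ := closure_ball η₀ hδ₁.ne'
  set a₀ := η₀ (Fin.last d) - δ₁ with ha₀_def
  have ha₀ : 0 < a₀ := by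
    have hmem : Function.update η₀ (Fin.last d) a₀ ∈ closure (Metric.ball η₀ δ₁) := by
      rw [hcl, Metric.mem_closedBall, dist_pi_le_iff hδ₁.le]
      intro i
      rcases eq_or_ne i (Fin.last d) with rfl | hi
      · simp [a₀, abs_of_pos hδ₁]
      · simp [Function.update_of_ne hi, hδ₁.le]
    simpa using hpos _ hmem
  have hcoord : ∀ η ∈ closure (Metric.ball η₀ δ₁), ∀ i, |η i - η₀ i| ≤ δ₁ := fun η hη i => by
    rw [hcl, Metric.mem_closedBall] at hη
    exact (dist_le_pi_dist η η₀ i).trans hη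
  have hlast : ∀ η ∈ closure (Metric.ball η₀ δ₁), a₀ ≤ η (Fin.last d) := fun η hη => by
    have := (abs_le.mp (hcoord η hη (Fin.last d))).1
    linarith
  set R := ‖η₀‖ + δ₁ with hR
  have hR0 : 0 ≤ R := by positivity
  have hcoordR : ∀ η ∈ closure (Metric.ball η₀ δ₁), ∀ i, |η i| ≤ R := fun η hη i => by
    have h1 := hcoord η hη i
    have h2 : |η₀ i| ≤ ‖η₀‖ := norm_le_pi_norm η₀ i
    calc |η i| = |η₀ i + (η i - η₀ i)| := by ring_nf
      _ ≤ |η₀ i| + |η i - η₀ i| := abs_add_le _ _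
      _ ≤ R := by linarith
  have hℓ : ∀ η ∈ closure (Metric.ball η₀ δ₁), ∀ v, |ℓ η v| ≤ d * R * ‖v‖ := fun η hη v => by
    have : ℓ η v = ∑ i : Fin d, η i.castSucc * v i := by simp [ℓ]
    rw [this]
    refine (Finset.abs_sum_le_sum_abs _ _).trans ?_
    refine (Finset.sum_le_card_nsmul _ _ (R * ‖v‖) fun i _ => ?_).trans (le_of_eq ?_)
    · rw [abs_mul]
      exact mul_le_mul (hcoordR η hη _) (norm_le_pi_norm v i) (abs_nonneg _) hR0
    · simp [mul_assoc]
  set C₁ := 2 / (a₀ * m / 2) + 4 / ((a₀ * m / 2) ^ 2 * δ₂ ^ 2) with hC₁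
  have hC₁0 : 0 ≤ C₁ := by positivity
  have hdist : ∀ η ∈ closure (Metric.ball η₀ δ₁), ∀ θ ∈ Θset, ‖θ - θstar η‖ ^ 2 ≤
      C₁ * ((ip η (θstar η) - ip η θ) + (ip η (θstar η) - ip η θ) ^ 2) := fun η hη θ hθ => by
    simp only [hip']
    refine hconv.sq_norm_sub_le_gap hsmooth (hθstar η hη).1 ha₀ (hlast η hη) hm hδ₂
      (fun y hy => by simpa only [hip'] using hmax η hη y hy) (fun y hy hyδ => ?_) hθ
    have hyball : y ∈ Metric.ball (θstar η) δ₂ := by rwa [mem_ball_iff_norm]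
    refine hcoer _ ?_ ?_ (hconv.fderiv_fderiv_apply_self_nonneg hy (hsmooth y hy)) ?_
    · rw [← norm_iteratedFDeriv_one, norm_iteratedFDeriv_fderiv]
      exact hP η hη y hyball
    · exact fun u v => ((hsmooth y hy).isSymmSndFDerivAt (by simp)) u v
    · simpa [iteratedFDeriv_two_apply] using (hdet η hη y hyball).le
  refine ⟨C₁ + 2 / a₀ ^ 2 * (1 + (d * R) ^ 2 * C₁), by positivity,
    fun η hη => ⟨?_, fun θ hθ i => ?_⟩⟩
  · simpa only [hip'] using
      hconv.const_sub_clm_sub_mul (ℓ η) (hpos η hη).le (ip η (θstar η))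
  have hx := hdist η hη θ hθ
  have hh0 : 0 ≤ ip η (θstar η) - ip η θ := sub_nonneg.mpr (hmax η hη θ hθ)
  have hgap : η (Fin.last d) * (A θ - A (θstar η)) =
      (ip η (θstar η) - ip η θ) + ℓ η (θ - θstar η) := by
    rw [hip', hip', map_sub]
    ring
  set h := ip η (θstar η) - ip η θ
  have hCi : 0 ≤ 2 / a₀ ^ 2 * (1 + (d * R) ^ 2 * C₁) := by positivity
  have hhh : 0 ≤ h + h ^ 2 := by positivity
  refine Fin.lastCases ?_ (fun i => ?_) i
  · simp only [Fin.snoc_last]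
    have h1 : ℓ η (θ - θstar η) ^ 2 ≤ (d * R) ^ 2 * (C₁ * (h + h ^ 2)) := by
      have := hℓ η hη (θ - θstar η)
      calc ℓ η (θ - θstar η) ^ 2 ≤ (d * R * ‖θ - θstar η‖) ^ 2 :=
            sq_le_sq' (neg_le_of_abs_le this) (le_of_abs_le this)
        _ = (d * R) ^ 2 * ‖θ - θstar η‖ ^ 2 := by ring
        _ ≤ _ := by gcongr
    have h2 : a₀ ^ 2 * (A θ - A (θstar η)) ^ 2 ≤ 2 * (1 + (d * R) ^ 2 * C₁) * (h + h ^ 2) := by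
      calc a₀ ^ 2 * (A θ - A (θstar η)) ^ 2
          ≤ η (Fin.last d) ^ 2 * (A θ - A (θstar η)) ^ 2 := by
            gcongr
            exact hlast η hη
        _ = (h + ℓ η (θ - θstar η)) ^ 2 := by rw [← mul_pow, hgap]
        _ ≤ 2 * h ^ 2 + 2 * ℓ η (θ - θstar η) ^ 2 := by
            nlinarith [sq_nonneg (h - ℓ η (θ - θstar η))]
        _ ≤ _ := by nlinarith
    calc (-A θ - -A (θstar η)) ^ 2 = (a₀ ^ 2 * (A θ - A (θstar η)) ^ 2) / a₀ ^ 2 := by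
          field_simp
          ring
      _ ≤ (2 * (1 + (d * R) ^ 2 * C₁) * (h + h ^ 2)) / a₀ ^ 2 := by gcongr
      _ = 2 / a₀ ^ 2 * (1 + (d * R) ^ 2 * C₁) * (h + h ^ 2) := by ring
      _ ≤ _ := mul_le_mul_of_nonneg_right (le_add_of_nonneg_left hC₁0) hhh
  · simp only [Fin.snoc_castSucc]
    have h1 : |θ i - θstar η i| ≤ ‖θ - θstar η‖ := norm_le_pi_norm (θ - θstar η) i
    calc (θ i - θstar η i) ^ 2 ≤ ‖θ - θstar η‖ ^ 2 :=
          sq_le_sq' (neg_le_of_abs_le h1) (le_of_abs_le h1)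
      _ ≤ C₁ * (h + h ^ 2) := hx
      _ ≤ _ := mul_le_mul_of_nonneg_right (le_add_of_nonneg_right hCi) hhh

/-- Under regularity assumptions, the covariance of the conjugate-prior sufficient
statistics `T(θ) = (θ, −A(θ))` under the posterior `p(·| k·η)` has spectral norm `< C/k`
for all large `k`, uniformly for `η` in a ball around `η₀`. -/
theorem conjugate_posterior_covariance_shrinks
    {𝒳 : Type*} [MeasurableSpace 𝒳] {d : ℕ}
    (ν : Measure 𝒳) [SigmaFinite ν]
    (S : 𝒳 → Fin d → ℝ) (hS : Measurable S)
    (Z : (Fin d → ℝ) → ℝ≥0∞)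
    (hZ : ∀ θ, Z θ = ∫⁻ x, ENNReal.ofReal (Real.exp (∑ i, θ i * S x i)) ∂ν)
    (A : (Fin d → ℝ) → ℝ) (hA : ∀ θ, A θ = Real.log (Z θ).toReal)
    (Θset : Set (Fin d → ℝ)) (hΘ : Θset = {θ | Z θ < ⊤})
    -- minimality of the likelihood family
    (hminimal : ¬ ∃ φ : Fin d → ℝ, φ ≠ 0 ∧ ∃ c : ℝ, ∀ᵐ x ∂ν, (∑ i, φ i * S x i) = c)
    -- ⟪η, T θ⟫ with T θ = (θ, −A θ)
    (ip : (Fin (d + 1) → ℝ) → (Fin d → ℝ) → ℝ)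
    (hip : ∀ η θ, ip η θ = (∑ i : Fin d, η i.castSucc * θ i) - η (Fin.last d) * A θ)
    (T : (Fin d → ℝ) → Fin (d + 1) → ℝ)
    (hT : ∀ θ, T θ = Fin.snoc θ (-(A θ)))
    -- conjugate-prior posterior density and its moments
    (ρ : (Fin (d + 1) → ℝ) → (Fin d → ℝ) → ℝ)
    (hρ : ∀ η θ, ρ η θ = Real.exp (ip η θ) / ∫ θ' in Θset, Real.exp (ip η θ'))
    (mT : (Fin (d + 1) → ℝ) → Fin (d + 1) → ℝ)
    (hmT : ∀ η i, mT η i = ∫ θ in Θset, T θ i * ρ η θ)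
    (covT : (Fin (d + 1) → ℝ) → Matrix (Fin (d + 1)) (Fin (d + 1)) ℝ)
    (hcovT : ∀ η i j, covT η i j =
      ∫ θ in Θset, (T θ i - mT η i) * (T θ j - mT η j) * ρ η θ)
    -- the neighborhood and the interior maximizers θ*_η
    (η₀ : Fin (d + 1) → ℝ) (δ₁ δ₂ : ℝ) (hδ₁ : 0 < δ₁) (hδ₂ : 0 < δ₂)
    (θstar : (Fin (d + 1) → ℝ) → Fin d → ℝ)
    (hθstar : ∀ η' ∈ closure (Metric.ball η₀ δ₁),
      θstar η' ∈ interior Θset ∧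
        ∀ θ ∈ Θset, θ ≠ θstar η' → ip η' θ < ip η' (θstar η'))
    -- the cone {k·η' : k > 1, η' ∈ closure of the ball} has finite log-normalizer
    (hcone : ∀ k : ℝ, 1 < k → ∀ η' ∈ closure (Metric.ball η₀ δ₁),
      IntegrableOn (fun θ => Real.exp (ip (k • η') θ)) Θset volume)
    -- A is differentiable of all orders
    (hAsmooth : ContDiffOn ℝ (⊤ : ℕ∞) A (interior Θset))
    -- partial derivatives of A up to order 7 are uniformly bounded near the maximizers
    (hbound : ∃ P : ℝ, ∀ η' ∈ closure (Metric.ball η₀ δ₁),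
      ∀ θ ∈ Metric.ball (θstar η') δ₂, ∀ n : ℕ, n ≤ 7 →
        ‖iteratedFDeriv ℝ n A θ‖ ≤ P)
    -- det ∇²A is uniformly bounded below near the maximizers
    (hdet : ∃ w > 0, ∀ η' ∈ closure (Metric.ball η₀ δ₁),
      ∀ θ ∈ Metric.ball (θstar η') δ₂,
        w < Matrix.det (Matrix.of fun i j : Fin d =>
          iteratedFDeriv ℝ 2 A θ ![Pi.single i 1, Pi.single j 1])) :
    ∃ C K : ℝ, ∀ k : ℝ, K < k → ∀ η ∈ Metric.ball η₀ δ₁,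
      ∀ v : Fin (d + 1) → ℝ, v ≠ 0 →
        Real.sqrt (∑ i, ((covT (k • η)).mulVec v i) ^ 2) <
          (C / k) * Real.sqrt (∑ i, (v i) ^ 2) := by
  subst hΘ
  obtain rfl : A = fun θ => Real.log (Z θ).toReal := funext hA
  set Θset : Set (Fin d → ℝ) := {θ | Z θ < ⊤} with hΘ
  set A : (Fin d → ℝ) → ℝ := fun θ => Real.log (Z θ).toReal with hA'
  have hconv : ConvexOn ℝ Θset A := convexOn_log_lintegral_exp ν hS hZ
  have hZm : Measurable Z := by
    rw [funext hZ]
    exact measurable_lintegral_exp ν hS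
  have hΘm : MeasurableSet Θset := measurableSet_lt hZm measurable_const
  have hAm : Measurable A := hZm.ennreal_toReal.log
  have hTm : ∀ i, Measurable fun θ => T θ i := fun i => by
    simp only [hT]
    refine Fin.lastCases ?_ (fun i => ?_) i
    · simp only [Fin.snoc_last]
      exact hAm.neg
    · simpa using measurable_pi_apply i
  obtain ⟨P, hP⟩ := hbound
  obtain ⟨C, hC, hgap⟩ := exists_forall_sq_snoc_sub_le hconv hip hδ₁ hδ₂ hθstar hAsmooth
    ⟨P, fun η hη θ hθ => hP η hη θ hθ 2 (by norm_num)⟩ hdet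
  simp only [← hT] at hgap
  refine ⟨(d + 1 : ℕ) * (C * 10 * 2 ^ d) + 1, 2, fun k hk η hη v hv => ?_⟩
  have hk0 : 0 < k := by linarith
  replace hη := subset_closure hη
  obtain ⟨hxint, hxmax⟩ := hθstar η hη
  set x := θstar η with hx
  have hxΘ : x ∈ Θset := interior_subset hxint
  set h : (Fin d → ℝ) → ℝ := fun θ => ip η x - ip η θ with hh
  have hh0 : ∀ θ ∈ Θset, 0 ≤ h θ := fun θ hθ => by
    rcases eq_or_ne θ x with rfl | hne
    · simp [hh]
    · exact (sub_pos.mpr (hxmax θ hθ hne)).le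
  have hipk : ∀ (c : ℝ) θ, ip (c • η) θ = c * ip η x - c * h θ := fun c θ => by
    simp only [hh, hip, Pi.smul_apply, smul_eq_mul, mul_assoc, ← Finset.mul_sum]
    ring
  have hexp_int : ∀ c : ℝ, 1 < c → IntegrableOn (fun θ => Real.exp (-(c * h θ))) Θset :=
    fun c hc => by
      refine ((hcone c hc η hη).const_mul (Real.exp (-(c * ip η x)))).congr
        (Filter.Eventually.of_forall fun θ => ?_)
      simp only [hipk, ← Real.exp_add]
      ring_nf
  obtain ⟨hgapconv, hgap⟩ := hgap η hη
  have hI := hexp_int k (by linarith)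
  have hI2 : IntegrableOn (fun θ => Real.exp (-(k * h θ / 2))) Θset := by
    refine (hexp_int (k / 2) (by linarith)).congr (Filter.Eventually.of_forall fun θ => ?_)
    ring_nf
  set D := ∫ θ in Θset, Real.exp (-(k * h θ)) with hD
  have hDpos : 0 < D := by
    have hvol : volume Θset ≠ 0 := (Measure.measure_pos_of_nonempty_interior volume ⟨x, hxint⟩).ne'
    have : NeZero (volume.restrict Θset) := ⟨by simpa using hvol⟩
    exact integral_exp_pos hI
  have hhalf : ∫ θ in Θset, Real.exp (-(k * h θ / 2)) ≤ 2 ^ d * D :=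
    hgapconv.setIntegral_exp_half_le hΘm hxΘ (sub_self _) hk0.le hI hI2
  have hρk : ∀ θ, ρ (k • η) θ = Real.exp (-(k * h θ)) / D := fun θ => by
    simp only [hρ, hipk, sub_eq_add_neg, Real.exp_add]
    rw [integral_const_mul, mul_div_mul_left _ _ (Real.exp_pos _).ne']
  have hρint : Integrable (ρ (k • η)) (volume.restrict Θset) := by
    rw [funext hρk]
    exact hI.div_const D
  have hρ1 : ∫ θ in Θset, ρ (k • η) θ = 1 := by
    simp_rw [hρk]
    rw [integral_div, div_self hDpos.ne']
  have hρ0 : ∀ θ, 0 ≤ ρ (k • η) θ := fun θ => by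
    rw [hρk]
    positivity
  set ε := C * 10 * 2 ^ d / k with hε
  have hε0 : 0 ≤ ε := by positivity
  have hdom : ∀ i, ∀ᵐ θ ∂volume.restrict Θset, ‖(T θ i - T x i) ^ 2 * ρ (k • η) θ‖ ≤
      C * 10 / (k * D) * Real.exp (-(k * h θ / 2)) := fun i => by
    filter_upwards [ae_restrict_mem hΘm] with θ hθ
    rw [Real.norm_of_nonneg (mul_nonneg (sq_nonneg _) (hρ0 θ)), hρk]
    calc (T θ i - T x i) ^ 2 * (Real.exp (-(k * h θ)) / D)
        ≤ C * (h θ + h θ ^ 2) * (Real.exp (-(k * h θ)) / D) :=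
          mul_le_mul_of_nonneg_right (hgap θ hθ i) (by positivity)
      _ = C / D * ((h θ + h θ ^ 2) * Real.exp (-(k * h θ))) := by ring
      _ ≤ C / D * (10 / k * Real.exp (-(k * h θ / 2))) :=
          mul_le_mul_of_nonneg_left (add_sq_mul_exp_neg_le (by linarith) (hh0 θ hθ))
            (by positivity)
      _ = C * 10 / (k * D) * Real.exp (-(k * h θ / 2)) := by
          field_simp
  have hmomint : ∀ i, Integrable (fun θ => (T θ i - T x i) ^ 2 * ρ (k • η) θ)
      (volume.restrict Θset) := fun i =>
    (hI2.const_mul _).mono'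
      ((((hTm i).sub_const _).pow_const 2).aestronglyMeasurable.mul hρint.1) (hdom i)
  have hmom : ∀ i, ∫ θ in Θset, (T θ i - T x i) ^ 2 * ρ (k • η) θ ≤ ε := fun i => by
    refine (le_abs_self _).trans
      ((norm_integral_le_of_norm_le (hI2.const_mul _) (hdom i)).trans ?_)
    rw [integral_const_mul]
    calc C * 10 / (k * D) * ∫ θ in Θset, Real.exp (-(k * h θ / 2))
        ≤ C * 10 / (k * D) * (2 ^ d * D) := by gcongr
      _ = ε := by
          rw [hε]
          field_simp
  have hcov : ∀ i j, |covT (k • η) i j| ≤ ε := fun i j => by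
    simp only [hcovT, hmT]
    exact abs_integral_sub_mul_sub_mul_le hρint hρ0 hρ1 (hTm i) (hTm j) (hmomint i)
      (hmomint j) (hmom i) (hmom j)
  refine (Matrix.sqrt_sum_sq_mulVec_le hε0 hcov v).trans_lt ?_
  have hvpos : 0 < √(∑ i, v i ^ 2) := by
    obtain ⟨i, hi⟩ := Function.ne_iff.mp hv
    exact Real.sqrt_pos.mpr (Finset.sum_pos' (fun i _ => sq_nonneg _)
      ⟨i, Finset.mem_univ i, sq_pos_of_ne_zero hi⟩)
  refine mul_lt_mul_of_pos_right ?_ hvpos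
  rw [hε, lt_div_iff₀ hk0]
  field_simp
  linarith
end
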